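/- Superconvergence of the MAC-E scheme for displacement and shear stress: there exist constants C > 0 and h₀ > 0, depending only on μ and the mesh-regularity constant C₀ (in particular independent of h, l and λ), such that if max(h, l) ≤ h₀ and (W^x, W^y, Z^{11}, Z^{22}, Z^{12}) solves the MAC-E scheme with data f¹, f² computed from the exact solution, then ‖W^x − ũ^x‖_{TM} + ‖W^y − ũ^y‖_{MT} ≤ C(h²+l²)(‖u‖_{3,∞} + ‖σ‖_{3,∞}) and ‖Z^{12} − σ̃^{12}‖_T ≤ Cμ(h²+l²)(‖u‖_{3,∞} + ‖σ‖_{3,∞}). -/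

import Mathlib

open Finset

noncomputable section

/-- The midpoint `x_{i+1/2} = (x_i + x_{i+1})/2`. -/
def midpt (x : ℕ → ℝ) (i : ℕ) : ℝ := (x i + x (i + 1)) / 2

/-- The cell width `h_{i+1/2} = x_{i+1} - x_i`. -/
def hMid (x : ℕ → ℝ) (i : ℕ) : ℝ := x (i + 1) - x i

/-- `h_i = x_{i+1/2} - x_{i-1/2}` for `1 ≤ i ≤ n-1`, together with the boundary
conventions `h_0 = h_{1/2}/2` and `h_n = h_{n-1/2}/2`. -/
def hNode (x : ℕ → ℝ) (n i : ℕ) : ℝ :=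
  if i = 0 then hMid x 0 / 2
  else if i = n then hMid x (n - 1) / 2
  else midpt x i - midpt x (i - 1)

/-- `0 = x_0 < x_1 < ⋯ < x_n = 1`. -/
def IsGrid (x : ℕ → ℝ) (n : ℕ) : Prop :=
  x 0 = 0 ∧ x n = 1 ∧ ∀ i < n, x i < x (i + 1)

/-- Discrete inner product `(φ,θ)_M` over the cell centers `(x_{i+1/2}, y_{j+1/2})`. -/
def ipM (x y : ℕ → ℝ) (nx ny : ℕ) (φ θ : ℕ → ℕ → ℝ) : ℝ :=
  ∑ i ∈ range nx, ∑ j ∈ range ny, hMid x i * hMid y j * φ i j * θ i j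

/-- Discrete inner product `(φ,θ)_T` over the grid nodes `(x_i, y_j)`. -/
def ipT (x y : ℕ → ℝ) (nx ny : ℕ) (φ θ : ℕ → ℕ → ℝ) : ℝ :=
  ∑ i ∈ range (nx + 1), ∑ j ∈ range (ny + 1), hNode x nx i * hNode y ny j * φ i j * θ i j

/-- Discrete inner product `(φ,θ)_{TM}` over the points `(x_i, y_{j+1/2})`,
`1 ≤ i ≤ n_x - 1`, `0 ≤ j ≤ n_y - 1`. -/
def ipTM (x y : ℕ → ℝ) (nx ny : ℕ) (φ θ : ℕ → ℕ → ℝ) : ℝ :=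
  ∑ i ∈ Ico 1 nx, ∑ j ∈ range ny, hNode x nx i * hMid y j * φ i j * θ i j

/-- Discrete inner product `(φ,θ)_{MT}` over the points `(x_{i+1/2}, y_j)`,
`0 ≤ i ≤ n_x - 1`, `1 ≤ j ≤ n_y - 1`. -/
def ipMT (x y : ℕ → ℝ) (nx ny : ℕ) (φ θ : ℕ → ℕ → ℝ) : ℝ :=
  ∑ i ∈ range nx, ∑ j ∈ Ico 1 ny, hMid x i * hNode y ny j * φ i j * θ i j

/-- `D_y` of an edge function `v` given at `(x-index, y_{j+1/2})` with extra boundary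
rows `v0` (at `y_0`) and `vn` (at `y_{n_y}`); the result is a node function. -/
def DyE (y : ℕ → ℝ) (ny : ℕ) (v : ℕ → ℕ → ℝ) (v0 vn : ℕ → ℝ) (i j : ℕ) : ℝ :=
  if j = 0 then (v i 0 - v0 i) / hNode y ny 0
  else if j = ny then (vn i - v i (ny - 1)) / hNode y ny ny
  else (v i j - v i (j - 1)) / hNode y ny j

/-- `D_x` of an edge function `v` given at `(x_{i+1/2}, y-index)` with extra boundary
columns `v0` (at `x_0`) and `vn` (at `x_{n_x}`); the result is a node function. -/
def DxE (x : ℕ → ℝ) (nx : ℕ) (v : ℕ → ℕ → ℝ) (v0 vn : ℕ → ℝ) (i j : ℕ) : ℝ :=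
  if i = 0 then (v 0 j - v0 j) / hNode x nx 0
  else if i = nx then (vn j - v (nx - 1) j) / hNode x nx nx
  else (v i j - v (i - 1) j) / hNode x nx i

/-- The MAC-E scheme on the staggered grid: `(Wx, Wy, Z11, Z22, Z12)` (with the extra
boundary rows/columns `Wx0, Wxn` of `Wx` at `y = y_0, y_{n_y}` and `Wy0, Wyn` of `Wy`
at `x = x_0, x_{n_x}`) solves the scheme with data `f1, f2`. -/
def MACESol (nx ny : ℕ) (x y : ℕ → ℝ) (lam mu : ℝ)
    (Wx : ℕ → ℕ → ℝ) (Wx0 Wxn : ℕ → ℝ)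
    (Wy : ℕ → ℕ → ℝ) (Wy0 Wyn : ℕ → ℝ)
    (Z11 Z22 Z12 f1 f2 : ℕ → ℕ → ℝ) : Prop :=
  -- boundary conditions for the displacements
  (∀ j < ny, Wx 0 j = 0 ∧ Wx nx j = 0) ∧
  (∀ i ≤ nx, Wx0 i = 0 ∧ Wxn i = 0) ∧
  (∀ i < nx, Wy i 0 = 0 ∧ Wy i ny = 0) ∧
  (∀ j ≤ ny, Wy0 j = 0 ∧ Wyn j = 0) ∧
  -- constitutive equations at the cell centers
  (∀ i < nx, ∀ j < ny,
    (1 / (2 * mu)) * (Z11 i j - lam / (2 * lam + 2 * mu) * (Z11 i j + Z22 i j))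
      = (Wx (i + 1) j - Wx i j) / hMid x i) ∧
  (∀ i < nx, ∀ j < ny,
    (1 / (2 * mu)) * (Z22 i j - lam / (2 * lam + 2 * mu) * (Z11 i j + Z22 i j))
      = (Wy i (j + 1) - Wy i j) / hMid y j) ∧
  -- shear stress equation at the grid nodes
  (∀ i ≤ nx, ∀ j ≤ ny,
    Z12 i j = mu * (DyE y ny Wx Wx0 Wxn i j + DxE x nx Wy Wy0 Wyn i j)) ∧
  -- momentum equations
  (∀ i, 1 ≤ i → i < nx → ∀ j < ny,
    (Z11 i j - Z11 (i - 1) j) / hNode x nx i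
      + (Z12 i (j + 1) - Z12 i j) / hMid y j = f1 i j) ∧
  (∀ i < nx, ∀ j, 1 ≤ j → j < ny →
    (Z12 (i + 1) j - Z12 i j) / hMid x i
      + (Z22 i j - Z22 i (j - 1)) / hNode y ny j = f2 i j)

/-- First partial derivative in `x`. -/
def pdx (f : ℝ × ℝ → ℝ) (p : ℝ × ℝ) : ℝ := deriv (fun t => f (t, p.2)) p.1

/-- First partial derivative in `y`. -/
def pdy (f : ℝ × ℝ → ℝ) (p : ℝ × ℝ) : ℝ := deriv (fun t => f (p.1, t)) p.2

/-- The norm `‖f‖_{3,∞}`: the sup over `[0,1]²` of the derivatives of `f` of order at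
most `3`. -/
def norm3 (f : ℝ × ℝ → ℝ) : ℝ :=
  ⨆ p : Set.Icc ((0 : ℝ), (0 : ℝ)) ((1 : ℝ), (1 : ℝ)), ⨆ k : Fin 4,
    ‖iteratedFDeriv ℝ (k : ℕ) f (p : ℝ × ℝ)‖

/-- The mesh size `h = max_i h_{i+1/2}`. -/
def hmax (x : ℕ → ℝ) (n : ℕ) : ℝ := ⨆ i : Fin n, hMid x i


/-! ### One-dimensional Taylor estimates -/

section Taylor

variable {f f1 f2 f3 : ℝ → ℝ} {a b M C : ℝ}

lemma abs_sub_le_mul_of_deriv_on_uIcc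
    (hR : ∀ t ∈ Set.uIcc a b, HasDerivAt f (f1 t) t)
    (hb : ∀ t ∈ Set.uIcc a b, |f1 t| ≤ C) : |f b - f a| ≤ C * |b - a| := by
  have := Convex.norm_image_sub_le_of_norm_hasDerivWithin_le (f := f) (f' := f1)
    (s := Set.uIcc a b) (C := C) (fun t ht => (hR t ht).hasDerivWithinAt)
    (fun t ht => by simpa using hb t ht) (convex_uIcc a b) Set.left_mem_uIcc Set.right_mem_uIcc
  simpa using this

lemma uIcc_subset_unit (ha : a ∈ Set.Icc (0 : ℝ) 1) (hb : b ∈ Set.Icc (0 : ℝ) 1) :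
    Set.uIcc a b ⊆ Set.Icc (0 : ℝ) 1 := Set.uIcc_subset_Icc ha hb

lemma abs_sub_le_of_mem_uIcc' {t : ℝ} (ht : t ∈ Set.uIcc a b) : |t - a| ≤ |b - a| := by
  have := Set.abs_sub_left_of_mem_uIcc ht
  simpa [abs_sub_comm] using this

lemma taylor_one (ha : a ∈ Set.Icc (0 : ℝ) 1) (hb : b ∈ Set.Icc (0 : ℝ) 1)
    (h1 : ∀ t ∈ Set.Icc (0 : ℝ) 1, HasDerivAt f (f1 t) t)
    (hM : ∀ t ∈ Set.Icc (0 : ℝ) 1, |f1 t| ≤ M) :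
    |f b - f a| ≤ M * |b - a| :=
  abs_sub_le_mul_of_deriv_on_uIcc (fun t ht => h1 t (uIcc_subset_unit ha hb ht))
    (fun t ht => hM t (uIcc_subset_unit ha hb ht))

lemma taylor_two (ha : a ∈ Set.Icc (0 : ℝ) 1) (hb : b ∈ Set.Icc (0 : ℝ) 1)
    (h1 : ∀ t ∈ Set.Icc (0 : ℝ) 1, HasDerivAt f (f1 t) t)
    (h2 : ∀ t ∈ Set.Icc (0 : ℝ) 1, HasDerivAt f1 (f2 t) t)
    (hM : ∀ t ∈ Set.Icc (0 : ℝ) 1, |f2 t| ≤ M) :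
    |f b - f a - (b - a) * f1 a| ≤ M * |b - a| ^ 2 := by
  have hM0 : 0 ≤ M := (abs_nonneg _).trans (hM a ha)
  have key := abs_sub_le_mul_of_deriv_on_uIcc (f := fun t => f t - t * f1 a)
    (f1 := fun t => f1 t - f1 a) (a := a) (b := b) (C := M * |b - a|)
    (fun t ht => by
      simpa using (h1 t (uIcc_subset_unit ha hb ht)).fun_sub ((hasDerivAt_id' t).mul_const (f1 a)))
    (fun t ht => (taylor_one ha (uIcc_subset_unit ha hb ht) h2 hM).trans
      (mul_le_mul_of_nonneg_left (abs_sub_le_of_mem_uIcc' ht) hM0))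
  calc |f b - f a - (b - a) * f1 a| = |f b - b * f1 a - (f a - a * f1 a)| := by congr 1; ring
    _ ≤ M * |b - a| * |b - a| := key
    _ = _ := by ring

lemma hasDerivAt_sub_sq_half (a t : ℝ) : HasDerivAt (fun t : ℝ => (t - a) ^ 2 / 2) (t - a) t := by
  exact ((((hasDerivAt_id' t).sub_const a).fun_pow 2).div_const 2).congr_deriv (by simp)

lemma taylor_three (ha : a ∈ Set.Icc (0 : ℝ) 1) (hb : b ∈ Set.Icc (0 : ℝ) 1)
    (h1 : ∀ t ∈ Set.Icc (0 : ℝ) 1, HasDerivAt f (f1 t) t)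
    (h2 : ∀ t ∈ Set.Icc (0 : ℝ) 1, HasDerivAt f1 (f2 t) t)
    (h3 : ∀ t ∈ Set.Icc (0 : ℝ) 1, HasDerivAt f2 (f3 t) t)
    (hM : ∀ t ∈ Set.Icc (0 : ℝ) 1, |f3 t| ≤ M) :
    |f b - f a - (b - a) * f1 a - (b - a) ^ 2 / 2 * f2 a| ≤ M * |b - a| ^ 3 := by
  have hM0 : 0 ≤ M := (abs_nonneg _).trans (hM a ha)
  have key := abs_sub_le_mul_of_deriv_on_uIcc
    (f := fun t => f t - t * f1 a - (t - a) ^ 2 / 2 * f2 a)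
    (f1 := fun t => f1 t - f1 a - (t - a) * f2 a) (a := a) (b := b) (C := M * |b - a| ^ 2)
    (fun t ht => by
      simpa using ((h1 t (uIcc_subset_unit ha hb ht)).fun_sub
        ((hasDerivAt_id' t).mul_const (f1 a))).fun_sub ((hasDerivAt_sub_sq_half a t).mul_const (f2 a)))
    (fun t ht => (taylor_two ha (uIcc_subset_unit ha hb ht) h2 h3 hM).trans
      (mul_le_mul_of_nonneg_left
        (pow_le_pow_left₀ (abs_nonneg _) (abs_sub_le_of_mem_uIcc' ht) 2) hM0))
  calc |f b - f a - (b - a) * f1 a - (b - a) ^ 2 / 2 * f2 a|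
      = |f b - b * f1 a - (b - a) ^ 2 / 2 * f2 a
          - (f a - a * f1 a - (a - a) ^ 2 / 2 * f2 a)| := by congr 1; ring
    _ ≤ M * |b - a| ^ 2 * |b - a| := key
    _ = _ := by ring

lemma hasDerivAt_integral_of_continuous (hf : Continuous f) (a t : ℝ) :
    HasDerivAt (fun t => ∫ s in a..t, f s) (f t) t :=
  intervalIntegral.integral_hasDerivAt_right (hf.intervalIntegrable _ _)
    (hf.stronglyMeasurableAtFilter _ _) hf.continuousAt

lemma integral_taylor_one (hf : Continuous f)
    (ha : a ∈ Set.Icc (0 : ℝ) 1) (hb : b ∈ Set.Icc (0 : ℝ) 1)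
    (h1 : ∀ t ∈ Set.Icc (0 : ℝ) 1, HasDerivAt f (f1 t) t)
    (hM : ∀ t ∈ Set.Icc (0 : ℝ) 1, |f1 t| ≤ M) :
    |(∫ s in a..b, f s) - (b - a) * f a| ≤ M * |b - a| ^ 2 := by
  simpa using taylor_two ha hb (fun t _ => hasDerivAt_integral_of_continuous hf a t) h1 hM

lemma integral_taylor_three (hf : Continuous f)
    (ha : a ∈ Set.Icc (0 : ℝ) 1) (hb : b ∈ Set.Icc (0 : ℝ) 1)
    (h1 : ∀ t ∈ Set.Icc (0 : ℝ) 1, HasDerivAt f (f1 t) t)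
    (h2 : ∀ t ∈ Set.Icc (0 : ℝ) 1, HasDerivAt f1 (f2 t) t)
    (h3 : ∀ t ∈ Set.Icc (0 : ℝ) 1, HasDerivAt f2 (f3 t) t)
    (hM : ∀ t ∈ Set.Icc (0 : ℝ) 1, |f3 t| ≤ M) :
    |(∫ s in a..b, f s) - (b - a) * f a - (b - a) ^ 2 / 2 * f1 a - (b - a) ^ 3 / 6 * f2 a|
      ≤ M * |b - a| ^ 4 := by
  have hM0 : 0 ≤ M := (abs_nonneg _).trans (hM a ha)
  have hcube : ∀ t : ℝ, HasDerivAt (fun t : ℝ => (t - a) ^ 3 / 6) ((t - a) ^ 2 / 2) t := by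
    intro t
    exact ((((hasDerivAt_id' t).sub_const a).fun_pow 3).div_const 6).congr_deriv (by simp; ring)
  have key := abs_sub_le_mul_of_deriv_on_uIcc
    (f := fun t => (∫ s in a..t, f s) - t * f a - (t - a) ^ 2 / 2 * f1 a - (t - a) ^ 3 / 6 * f2 a)
    (f1 := fun t => f t - f a - (t - a) * f1 a - (t - a) ^ 2 / 2 * f2 a) (a := a) (b := b)
    (C := M * |b - a| ^ 3)
    (fun t ht => by
      simpa using (((hasDerivAt_integral_of_continuous hf a t).fun_sub
        ((hasDerivAt_id' t).mul_const (f a))).fun_sub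
          ((hasDerivAt_sub_sq_half a t).mul_const (f1 a))).fun_sub ((hcube t).mul_const (f2 a)))
    (fun t ht => (taylor_three ha (uIcc_subset_unit ha hb ht) h1 h2 h3 hM).trans
      (mul_le_mul_of_nonneg_left
        (pow_le_pow_left₀ (abs_nonneg _) (abs_sub_le_of_mem_uIcc' ht) 3) hM0))
  calc _ = |(∫ s in a..b, f s) - b * f a - (b - a) ^ 2 / 2 * f1 a - (b - a) ^ 3 / 6 * f2 a
          - ((∫ s in a..a, f s) - a * f a - (a - a) ^ 2 / 2 * f1 a - (a - a) ^ 3 / 6 * f2 a)| := by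
        congr 1; simp; ring
    _ ≤ M * |b - a| ^ 3 * |b - a| := key
    _ = _ := by ring

lemma midpoint_mem_unit (ha : a ∈ Set.Icc (0 : ℝ) 1) (hb : b ∈ Set.Icc (0 : ℝ) 1) :
    (a + b) / 2 ∈ Set.Icc (0 : ℝ) 1 := by
  obtain ⟨h1, h2⟩ := ha
  obtain ⟨h3, h4⟩ := hb
  constructor <;> linarith

lemma sub_eq_midpoint_deriv (ha : a ∈ Set.Icc (0 : ℝ) 1) (hb : b ∈ Set.Icc (0 : ℝ) 1)
    (h1 : ∀ t ∈ Set.Icc (0 : ℝ) 1, HasDerivAt f (f1 t) t)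
    (h2 : ∀ t ∈ Set.Icc (0 : ℝ) 1, HasDerivAt f1 (f2 t) t)
    (h3 : ∀ t ∈ Set.Icc (0 : ℝ) 1, HasDerivAt f2 (f3 t) t)
    (hM : ∀ t ∈ Set.Icc (0 : ℝ) 1, |f3 t| ≤ M) :
    |f b - f a - (b - a) * f1 ((a + b) / 2)| ≤ M * |b - a| ^ 3 := by
  have hM0 : 0 ≤ M := (abs_nonneg _).trans (hM a ha)
  have hm := midpoint_mem_unit ha hb
  have e1 := taylor_three hm hb h1 h2 h3 hM
  have e2 := taylor_three hm ha h1 h2 h3 hM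
  have q1 : b - (a + b) / 2 = (b - a) / 2 := by ring
  have q2 : a - (a + b) / 2 = -((b - a) / 2) := by ring
  rw [q1] at e1
  rw [q2, abs_neg] at e2
  have q3 : |(b - a) / 2| = |b - a| / 2 := by rw [abs_div]; norm_num
  rw [q3] at e1 e2
  have h8 : 0 ≤ M * |b - a| ^ 3 := by positivity
  rw [abs_le] at *
  constructor <;> nlinarith [e1.1, e1.2, e2.1, e2.2]

lemma integral_eq_midpoint (hf : Continuous f)
    (ha : a ∈ Set.Icc (0 : ℝ) 1) (hb : b ∈ Set.Icc (0 : ℝ) 1)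
    (h1 : ∀ t ∈ Set.Icc (0 : ℝ) 1, HasDerivAt f (f1 t) t)
    (h2 : ∀ t ∈ Set.Icc (0 : ℝ) 1, HasDerivAt f1 (f2 t) t)
    (hM : ∀ t ∈ Set.Icc (0 : ℝ) 1, |f2 t| ≤ M) :
    |(∫ s in a..b, f s) - (b - a) * f ((a + b) / 2)| ≤ M * |b - a| ^ 3 := by
  simpa using sub_eq_midpoint_deriv ha hb
    (fun t _ => hasDerivAt_integral_of_continuous hf a t) h1 h2 hM

lemma abs_integral_le_of_unit
    (ha : a ∈ Set.Icc (0 : ℝ) 1) (hb : b ∈ Set.Icc (0 : ℝ) 1)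
    (hM : ∀ t ∈ Set.Icc (0 : ℝ) 1, |f t| ≤ M) : |∫ s in a..b, f s| ≤ M * |b - a| := by
  have := intervalIntegral.norm_integral_le_of_norm_le_const (a := a) (b := b) (f := f) (C := M)
    (fun t ht => by
      simpa using hM t (uIcc_subset_unit ha hb (Set.uIoc_subset_uIcc ht)))
  simpa using this

/-- The value at the midpoint of `[a, b]` (with `b` possibly below `a`), corrected by
`-(b - a)² / 8 f''`, agrees with the linear Taylor polynomial at `a` up to third order. -/
lemma corrected_midpoint_expansion (ha : a ∈ Set.Icc (0 : ℝ) 1) (hb : b ∈ Set.Icc (0 : ℝ) 1)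
    (h1 : ∀ t ∈ Set.Icc (0 : ℝ) 1, HasDerivAt f (f1 t) t)
    (h2 : ∀ t ∈ Set.Icc (0 : ℝ) 1, HasDerivAt f1 (f2 t) t)
    (h3 : ∀ t ∈ Set.Icc (0 : ℝ) 1, HasDerivAt f2 (f3 t) t)
    (hM : ∀ t ∈ Set.Icc (0 : ℝ) 1, |f3 t| ≤ M) :
    |f ((a + b) / 2) - (b - a) ^ 2 / 8 * f2 ((a + b) / 2) - f a - (b - a) / 2 * f1 a|
      ≤ M * |b - a| ^ 3 := by
  have hM0 : 0 ≤ M := (abs_nonneg _).trans (hM a ha)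
  have hm := midpoint_mem_unit ha hb
  have e1 := taylor_three ha hm h1 h2 h3 hM
  have e2 := taylor_one ha hm h3 hM
  have q1 : (a + b) / 2 - a = (b - a) / 2 := by ring
  have q3 : |(b - a) / 2| = |b - a| / 2 := by rw [abs_div]; norm_num
  rw [q1, q3] at e1 e2
  have e4 : |(b - a) ^ 2 / 8 * (f2 ((a + b) / 2) - f2 a)| ≤ |b - a| ^ 2 / 8 * (M * (|b - a| / 2)) := by
    rw [abs_mul, abs_div, abs_pow]
    norm_num
    gcongr
  have h8 : 0 ≤ M * |b - a| ^ 3 := by positivity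
  rw [abs_le] at *
  constructor <;> nlinarith [e1.1, e1.2, e4.1, e4.2]

end Taylor

/-! ### Grids -/

section Grid

variable {x : ℕ → ℝ} {n : ℕ}

lemma IsGrid.hMid_pos (hx : IsGrid x n) {i : ℕ} (hi : i < n) : 0 < hMid x i :=
  sub_pos.2 (hx.2.2 i hi)

lemma hMid_le_hmax {i : ℕ} (hi : i < n) : hMid x i ≤ hmax x n :=
  le_ciSup (f := fun i : Fin n => hMid x i) (Set.finite_range _).bddAbove ⟨i, hi⟩

lemma IsGrid.sum_hMid (hx : IsGrid x n) (j : ℕ) : ∑ k ∈ range j, hMid x k = x j := by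
  simp only [hMid]
  rw [Finset.sum_range_sub, hx.1, sub_zero]

lemma IsGrid.nonneg (hx : IsGrid x n) {j : ℕ} (hj : j ≤ n) : 0 ≤ x j := by
  rw [← hx.sum_hMid j]
  exact Finset.sum_nonneg fun k hk =>
    (hx.hMid_pos (lt_of_lt_of_le (Finset.mem_range.1 hk) hj)).le

lemma IsGrid.le_one (hx : IsGrid x n) {j : ℕ} (hj : j ≤ n) : x j ≤ 1 := by
  rw [← hx.2.1, ← hx.sum_hMid j, ← hx.sum_hMid n]
  exact Finset.sum_le_sum_of_subset_of_nonneg (by simpa using hj)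
    fun _ hk _ => (hx.hMid_pos (Finset.mem_range.1 hk)).le

lemma IsGrid.mem_unit (hx : IsGrid x n) {j : ℕ} (hj : j ≤ n) : x j ∈ Set.Icc (0 : ℝ) 1 :=
  ⟨hx.nonneg hj, hx.le_one hj⟩

lemma IsGrid.midpt_mem_unit (hx : IsGrid x n) {j : ℕ} (hj : j < n) :
    midpt x j ∈ Set.Icc (0 : ℝ) 1 :=
  midpoint_mem_unit (hx.mem_unit hj.le) (hx.mem_unit hj)

lemma IsGrid.mem_Ioo (hx : IsGrid x n) {j : ℕ} (h0 : j ≠ 0) (hj : j < n) :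
    x j ∈ Set.Ioo (0 : ℝ) 1 := by
  obtain ⟨k, rfl⟩ := Nat.exists_eq_succ_of_ne_zero h0
  constructor
  · have h1 := hx.hMid_pos (i := k) (by omega)
    have h2 := hx.nonneg (j := k) (by omega)
    simp only [hMid] at h1
    simp only [Nat.succ_eq_add_one]
    linarith
  · have h1 := hx.hMid_pos hj
    have h2 := hx.le_one (j := k + 1 + 1) (by omega)
    simp only [hMid, Nat.succ_eq_add_one] at *
    linarith

lemma hNode_zero : hNode x n 0 = hMid x 0 / 2 := by simp [hNode]

lemma hNode_last (hn : n ≠ 0) : hNode x n n = hMid x (n - 1) / 2 := by simp [hNode, hn]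

lemma hNode_interior {i : ℕ} (h0 : i ≠ 0) (hi : i ≠ n) :
    hNode x n i = (hMid x i + hMid x (i - 1)) / 2 := by
  obtain ⟨k, rfl⟩ := Nat.exists_eq_succ_of_ne_zero h0
  simp only [hNode, h0, hi, if_false, midpt, hMid, Nat.succ_eq_add_one, Nat.add_sub_cancel]
  ring

lemma IsGrid.pos (hx : IsGrid x n) : 0 < n := by
  rcases Nat.eq_zero_or_pos n with rfl | h
  · have := hx.1.symm.trans hx.2.1
    norm_num at this
  · exact h

lemma IsGrid.hNode_pos (hx : IsGrid x n) {i : ℕ} (hi : i ≤ n) : 0 < hNode x n i := by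
  have hn := hx.pos
  rcases eq_or_ne i 0 with rfl | h0
  · rw [hNode_zero]
    linarith [hx.hMid_pos hn]
  rcases eq_or_ne i n with rfl | h1
  · rw [hNode_last h0]
    linarith [hx.hMid_pos (i := i - 1) (by omega)]
  · rw [hNode_interior h0 h1]
    linarith [hx.hMid_pos (i := i - 1) (by omega), hx.hMid_pos (i := i) (by omega)]

lemma IsGrid.sum_hNode_interior (hx : IsGrid x n) :
    ∑ i ∈ Ico 1 n, hNode x n i = midpt x (n - 1) - midpt x 0 := by
  have hn := hx.pos
  have hc : ∀ i ∈ Ico 1 n, hNode x n i = midpt x i - midpt x (i - 1) := by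
    intro i hi
    rw [Finset.mem_Ico] at hi
    simp only [hNode, show i ≠ 0 by omega, show i ≠ n by omega, if_false]
  rw [Finset.sum_congr rfl hc, Finset.sum_Ico_eq_sum_range]
  have := Finset.sum_range_sub (fun k => midpt x k) (n - 1)
  rw [← this]
  refine Finset.sum_congr rfl fun k _ => ?_
  rw [Nat.add_comm 1 k, Nat.add_sub_cancel]

lemma sum_range_succ_eq_ends {n : ℕ} (hn : 0 < n) (F : ℕ → ℝ) :
    ∑ i ∈ range (n + 1), F i = F 0 + ∑ i ∈ Ico 1 n, F i + F n := by
  rw [Finset.sum_range_succ, Finset.range_eq_Ico, Finset.sum_eq_sum_Ico_succ_bot hn]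

lemma IsGrid.sum_hNode (hx : IsGrid x n) : ∑ i ∈ range (n + 1), hNode x n i = 1 := by
  have hn := hx.pos
  rw [sum_range_succ_eq_ends hn, hx.sum_hNode_interior, hNode_zero, hNode_last hn.ne']
  have e : n - 1 + 1 = n := by omega
  simp only [midpt, hMid, e, hx.1, hx.2.1]
  ring

lemma IsGrid.sum_hNode_interior_le (hx : IsGrid x n) : ∑ i ∈ Ico 1 n, hNode x n i ≤ 1 := by
  have hn := hx.pos
  have h := hx.sum_hNode
  rw [sum_range_succ_eq_ends hn] at h
  linarith [hx.hNode_pos (i := 0) hn.le, hx.hNode_pos (i := n) le_rfl]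

/-! ### The mesh function of the corrector -/

/-- `∑_{k<n} h_{k+1/2}³`. -/
def cubeSum (x : ℕ → ℝ) (n : ℕ) : ℝ := ∑ k ∈ range n, hMid x k ^ 3

/-- One sixth of `∑_{k<j} h_{k+1/2}³`, minus a smooth function with vanishing derivative at
both ends that makes it vanish at `j = n`. -/
def corrector (x : ℕ → ℝ) (n j : ℕ) : ℝ :=
  (cubeSum x j - cubeSum x n * (3 * x j ^ 2 - 2 * x j ^ 3)) / 6

lemma IsGrid.cubeSum_nonneg (hx : IsGrid x n) {j : ℕ} (hj : j ≤ n) : 0 ≤ cubeSum x j :=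
  Finset.sum_nonneg fun _ hk =>
    pow_nonneg (hx.hMid_pos (lt_of_lt_of_le (Finset.mem_range.1 hk) hj)).le 3

lemma IsGrid.cubeSum_le (hx : IsGrid x n) {j : ℕ} (hj : j ≤ n) :
    cubeSum x j ≤ hmax x n ^ 2 := by
  have h1 : cubeSum x j ≤ ∑ k ∈ range j, hmax x n ^ 2 * hMid x k := by
    refine Finset.sum_le_sum fun k hk => ?_
    have hk' := lt_of_lt_of_le (Finset.mem_range.1 hk) hj
    have h0 := (hx.hMid_pos hk').le
    have h2 := hMid_le_hmax (x := x) hk'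
    calc hMid x k ^ 3 = hMid x k ^ 2 * hMid x k := by ring
      _ ≤ _ := by gcongr
  rw [← Finset.mul_sum, hx.sum_hMid] at h1
  exact h1.trans (mul_le_of_le_one_right (sq_nonneg _) (hx.le_one hj))

lemma corrector_zero (hx : IsGrid x n) : corrector x n 0 = 0 := by
  simp [corrector, cubeSum, hx.1]

lemma corrector_last (hx : IsGrid x n) : corrector x n n = 0 := by
  simp [corrector, hx.2.1]; norm_num

lemma IsGrid.abs_corrector_le (hx : IsGrid x n) {j : ℕ} (hj : j ≤ n) :
    |corrector x n j| ≤ hmax x n ^ 2 := by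
  have h1 := hx.cubeSum_nonneg hj
  have h2 := hx.cubeSum_le hj
  have h3 := hx.cubeSum_nonneg le_rfl
  have h4 := hx.cubeSum_le le_rfl
  have h5 := hx.nonneg hj
  have h6 := hx.le_one hj
  have h7 : 0 ≤ 3 * x j ^ 2 - 2 * x j ^ 3 := by
    have : 0 ≤ x j ^ 2 * (3 - 2 * x j) := mul_nonneg (sq_nonneg _) (by linarith)
    linarith
  have h8 : 3 * x j ^ 2 - 2 * x j ^ 3 ≤ 1 := by
    have : 0 ≤ (1 - x j) ^ 2 * (1 + 2 * x j) := mul_nonneg (sq_nonneg _) (by linarith)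
    linarith
  have h9 := mul_nonneg h3 h7
  have h10 := mul_le_of_le_one_right h3 h8
  have h11 := sq_nonneg (hmax x n)
  rw [corrector, abs_le]
  constructor <;> linarith

lemma corrector_succ_sub (j : ℕ) : corrector x n (j + 1) - corrector x n j
    = ((x (j + 1) - x j) ^ 3 - cubeSum x n * ((3 * x (j + 1) ^ 2 - 2 * x (j + 1) ^ 3)
      - (3 * x j ^ 2 - 2 * x j ^ 3))) / 6 := by
  simp only [corrector]
  rw [show cubeSum x (j + 1) = cubeSum x j + (x (j + 1) - x j) ^ 3 from Finset.sum_range_succ _ _]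
  ring

lemma abs_cubic_sub_le {a b : ℝ} (ha : a ∈ Set.Icc (0 : ℝ) 1) (hb : b ∈ Set.Icc (0 : ℝ) 1) :
    |(3 * b ^ 2 - 2 * b ^ 3) - (3 * a ^ 2 - 2 * a ^ 3) - (b - a) * (6 * a - 6 * a ^ 2)|
      ≤ 3 * |b - a| ^ 2 := by
  obtain ⟨h1, h2⟩ := ha
  obtain ⟨h3, h4⟩ := hb
  have : (3 * b ^ 2 - 2 * b ^ 3) - (3 * a ^ 2 - 2 * a ^ 3) - (b - a) * (6 * a - 6 * a ^ 2)
      = (3 - 4 * a - 2 * b) * (b - a) ^ 2 := by ring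
  rw [this, abs_mul, abs_pow]
  gcongr
  rw [abs_le]
  constructor <;> linarith

lemma abs_cubic_deriv_le {a : ℝ} (ha : a ∈ Set.Icc (0 : ℝ) 1) : |6 * a - 6 * a ^ 2| ≤ 3 / 2 := by
  obtain ⟨h1, h2⟩ := ha
  rw [abs_le]
  constructor <;> nlinarith [sq_nonneg (2 * a - 1)]

lemma IsGrid.abs_corrector_succ_sub_le (hx : IsGrid x n) {j : ℕ} (hj : j < n) :
    |corrector x n (j + 1) - corrector x n j| ≤ 2 * hmax x n ^ 2 * hMid x j := by
  have h0 := hx.hMid_pos hj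
  have h1 := hMid_le_hmax (x := x) hj
  have h2 := hx.cubeSum_nonneg le_rfl
  have h3 := hx.cubeSum_le le_rfl
  have ha := hx.mem_unit hj.le
  have hb := hx.mem_unit (j := j + 1) hj
  have h4 : |(3 * x (j + 1) ^ 2 - 2 * x (j + 1) ^ 3) - (3 * x j ^ 2 - 2 * x j ^ 3)|
      ≤ 6 * hMid x j := by
    have e1 := abs_cubic_sub_le ha hb
    have e2 := abs_cubic_deriv_le ha
    have hd : x (j + 1) - x j = hMid x j := rfl
    rw [hd, abs_of_pos h0] at e1
    have h5 : hMid x j ≤ 1 := by rw [← hd]; linarith [ha.1, hb.2]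
    have h6 : hMid x j ^ 2 ≤ hMid x j := by nlinarith
    have e3 : |hMid x j * (6 * x j - 6 * x j ^ 2)| ≤ hMid x j * (3 / 2) := by
      rw [abs_mul, abs_of_pos h0]; gcongr
    rw [abs_le] at *
    constructor <;> linarith [e1.1, e1.2, e3.1, e3.2]
  have h5 : |cubeSum x n * ((3 * x (j + 1) ^ 2 - 2 * x (j + 1) ^ 3)
      - (3 * x j ^ 2 - 2 * x j ^ 3))| ≤ hmax x n ^ 2 * (6 * hMid x j) := by
    rw [abs_mul, abs_of_nonneg h2]; gcongr
  have h6 : hMid x j ^ 3 ≤ hmax x n ^ 2 * hMid x j := by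
    calc hMid x j ^ 3 = hMid x j ^ 2 * hMid x j := by ring
      _ ≤ _ := by gcongr
  have h7 : 0 < hMid x j ^ 3 := by positivity
  rw [corrector_succ_sub, show x (j + 1) - x j = hMid x j from rfl]
  rw [abs_le] at *
  have h8 : 0 ≤ hmax x n ^ 2 * hMid x j := by positivity
  constructor <;> linarith [h5.1, h5.2]

end Grid

/-! ### Consistency of one-dimensional difference quotients -/

section Consistency

variable {f f1 f2 f3 f4 k k1 : ℝ → ℝ} {M K H : ℝ}

lemma flux_expansion {a b Pa Pb Λ : ℝ}
    (ha : a ∈ Set.Icc (0 : ℝ) 1) (hb : b ∈ Set.Icc (0 : ℝ) 1)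
    (hf : Continuous f) (hk : Continuous k)
    (h1 : ∀ t ∈ Set.Icc (0 : ℝ) 1, HasDerivAt f (f1 t) t)
    (h2 : ∀ t ∈ Set.Icc (0 : ℝ) 1, HasDerivAt f1 (f2 t) t)
    (h3 : ∀ t ∈ Set.Icc (0 : ℝ) 1, HasDerivAt f2 (f3 t) t)
    (h4 : ∀ t ∈ Set.Icc (0 : ℝ) 1, HasDerivAt f3 (f4 t) t)
    (hk1 : ∀ t ∈ Set.Icc (0 : ℝ) 1, HasDerivAt k (k1 t) t)
    (hM2 : ∀ t ∈ Set.Icc (0 : ℝ) 1, |f2 t| ≤ M)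
    (hM3 : ∀ t ∈ Set.Icc (0 : ℝ) 1, |f3 t| ≤ M)
    (hM4 : ∀ t ∈ Set.Icc (0 : ℝ) 1, |f4 t| ≤ M)
    (hK : ∀ t ∈ Set.Icc (0 : ℝ) 1, |k1 t| ≤ K)
    (hPa : |Pa| ≤ H ^ 2) (hΛ0 : 0 ≤ Λ) (hΛ : Λ ≤ H ^ 2) (hH : |b - a| ≤ H)
    (hP : Pb - Pa = ((b - a) ^ 3
      - Λ * ((3 * b ^ 2 - 2 * b ^ 3) - (3 * a ^ 2 - 2 * a ^ 3))) / 6) :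
    |(∫ s in a..b, (f s - k s)) - (Pb * f2 b - Pa * f2 a)
      - (b - a) * (f a - k a - Pa * f3 a + Λ / 6 * (6 * a - 6 * a ^ 2) * f2 a)
      - (b - a) ^ 2 / 2 * f1 a| ≤ |b - a| ^ 2 * (3 * H ^ 2 * M + K) := by
  have hM0 : 0 ≤ M := (abs_nonneg _).trans (hM2 a ha)
  have T1 := integral_taylor_three hf ha hb h1 h2 h3 hM3
  have T2 := integral_taylor_one hk ha hb hk1 hK
  have T3 := taylor_two ha hb h3 h4 hM4
  have T4 := taylor_one ha hb h3 hM3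
  have T5 := abs_cubic_sub_le ha hb
  have T6 := abs_cubic_deriv_le ha
  set δ := b - a with hδ
  set I1 := ∫ s in a..b, f s
  set I2 := ∫ s in a..b, k s
  have hint : (∫ s in a..b, (f s - k s)) = I1 - I2 :=
    intervalIntegral.integral_sub (hf.intervalIntegrable _ _) (hk.intervalIntegrable _ _)
  set r0 := I1 - δ * f a - δ ^ 2 / 2 * f1 a - δ ^ 3 / 6 * f2 a
  set rk := I2 - δ * k a
  set r1 := f2 b - f2 a - δ * f3 a
  set r3 := f2 b - f2 a
  set r2 := (3 * b ^ 2 - 2 * b ^ 3) - (3 * a ^ 2 - 2 * a ^ 3) - δ * (6 * a - 6 * a ^ 2)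
  set θ1 := 6 * a - 6 * a ^ 2
  have hPb : Pb = Pa + (δ ^ 3 - Λ * (r2 + δ * θ1)) / 6 := by
    have : (3 * b ^ 2 - 2 * b ^ 3) - (3 * a ^ 2 - 2 * a ^ 3) = r2 + δ * θ1 := by ring
    rw [this] at hP
    linarith
  have hid : (∫ s in a..b, (f s - k s)) - (Pb * f2 b - Pa * f2 a)
      - δ * (f a - k a - Pa * f3 a + Λ / 6 * θ1 * f2 a) - δ ^ 2 / 2 * f1 a
      = r0 - rk - Pa * r1 - δ ^ 3 / 6 * r3 + Λ / 6 * (θ1 * (δ * r3)) + Λ / 6 * (r2 * f2 b) := by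
    rw [hint, hPb]; ring
  rw [hid]
  have hd0 : 0 ≤ |δ| := abs_nonneg _
  have hH0 : 0 ≤ H := hd0.trans hH
  have hd2 : |δ| ^ 2 ≤ H ^ 2 := by gcongr
  have b1 : |r0| ≤ |δ| ^ 2 * (H ^ 2 * M) := T1.trans (by
    calc M * |δ| ^ 4 = |δ| ^ 2 * (|δ| ^ 2 * M) := by ring
      _ ≤ _ := by gcongr)
  have b3 : |Pa * r1| ≤ |δ| ^ 2 * (H ^ 2 * M) := by
    rw [abs_mul]
    calc |Pa| * |r1| ≤ H ^ 2 * (M * |δ| ^ 2) := by gcongr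
      _ = _ := by ring
  have b4 : |δ ^ 3 / 6 * r3| ≤ |δ| ^ 2 * (H ^ 2 * M) / 6 := by
    rw [abs_mul, abs_div, abs_pow, abs_of_pos (by norm_num : (0 : ℝ) < 6)]
    calc |δ| ^ 3 / 6 * |r3| ≤ |δ| ^ 3 / 6 * (M * |δ|) := by gcongr
      _ = |δ| ^ 2 * (|δ| ^ 2 * M) / 6 := by ring
      _ ≤ _ := by gcongr
  have b5 : |Λ / 6 * (θ1 * (δ * r3))| ≤ |δ| ^ 2 * (H ^ 2 * M) / 4 := by
    rw [abs_mul, abs_mul, abs_mul, abs_of_nonneg (by positivity : 0 ≤ Λ / 6)]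
    calc Λ / 6 * (|θ1| * (|δ| * |r3|)) ≤ H ^ 2 / 6 * (3 / 2 * (|δ| * (M * |δ|))) := by gcongr
      _ = _ := by ring
  have b6 : |Λ / 6 * (r2 * f2 b)| ≤ |δ| ^ 2 * (H ^ 2 * M) / 2 := by
    rw [abs_mul, abs_mul, abs_of_nonneg (by positivity : 0 ≤ Λ / 6)]
    have := hM2 b hb
    calc Λ / 6 * (|r2| * |f2 b|) ≤ H ^ 2 / 6 * (3 * |δ| ^ 2 * M) := by gcongr
      _ = _ := by ring
  have h8 : 0 ≤ |δ| ^ 2 * (H ^ 2 * M) := by positivity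
  rw [abs_le] at *
  constructor <;> linarith [b1.1, b1.2, T2.1, T2.2, b3.1, b3.2, b4.1, b4.2, b5.1, b5.2, b6.1, b6.2]

/-- The edge flux `(∫ f - [P g]) / h_{j+1/2}` over the `j`-th cell. -/
def edgeFlux (y P : ℕ → ℝ) (f g : ℝ → ℝ) (j : ℕ) : ℝ :=
  ((∫ s in y j..y (j + 1), f s) - (P (j + 1) * g (y (j + 1)) - P j * g (y j))) / hMid y j

lemma DyE_edgeFlux {y : ℕ → ℝ} {n : ℕ} (hy : IsGrid y n)
    (hf : Continuous f) (hk : Continuous k)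
    (h1 : ∀ t ∈ Set.Icc (0 : ℝ) 1, HasDerivAt f (f1 t) t)
    (h2 : ∀ t ∈ Set.Icc (0 : ℝ) 1, HasDerivAt f1 (f2 t) t)
    (h3 : ∀ t ∈ Set.Icc (0 : ℝ) 1, HasDerivAt f2 (f3 t) t)
    (h4 : ∀ t ∈ Set.Icc (0 : ℝ) 1, HasDerivAt f3 (f4 t) t)
    (hk1 : ∀ t ∈ Set.Icc (0 : ℝ) 1, HasDerivAt k (k1 t) t)
    (hM2 : ∀ t ∈ Set.Icc (0 : ℝ) 1, |f2 t| ≤ M)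
    (hM3 : ∀ t ∈ Set.Icc (0 : ℝ) 1, |f3 t| ≤ M)
    (hM4 : ∀ t ∈ Set.Icc (0 : ℝ) 1, |f4 t| ≤ M)
    (hK : ∀ t ∈ Set.Icc (0 : ℝ) 1, |k1 t| ≤ K)
    (hf0 : f 0 = 0) (hfn : f 1 = 0) (hk0 : k 0 = 0) (hkn : k 1 = 0)
    {v : ℕ → ℕ → ℝ} {i j : ℕ} (hj : j ≤ n)
    (hv : ∀ j, v i j = edgeFlux y (corrector y n) (fun s => f s - k s) f2 j) :
    |DyE y n v (fun _ => 0) (fun _ => 0) i j - f1 (y j)|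
      ≤ 2 * (3 * hmax y n ^ 2 * M + K) := by
  set E := 3 * hmax y n ^ 2 * M + K with hE
  have hn := hy.pos
  have hΛ0 := hy.cubeSum_nonneg le_rfl
  have hΛ := hy.cubeSum_le le_rfl
  set c := f (y j) - k (y j) - corrector y n j * f3 (y j)
    + cubeSum y n / 6 * (6 * y j - 6 * y j ^ 2) * f2 (y j) with hc
  have right : j < n → |v i j - c - hMid y j / 2 * f1 (y j)| ≤ hMid y j * E := by
    intro hjn
    have hl := hy.hMid_pos hjn
    have key := flux_expansion (hy.mem_unit hj) (hy.mem_unit (j := j + 1) hjn) hf hk h1 h2 h3 h4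
      hk1 hM2 hM3 hM4 hK (hy.abs_corrector_le hj) hΛ0 hΛ
      (by rw [show y (j + 1) - y j = hMid y j from rfl, abs_of_pos hl]; exact hMid_le_hmax hjn)
      (corrector_succ_sub j)
    rw [show y (j + 1) - y j = hMid y j from rfl, abs_of_pos hl, ← hc, ← hE] at key
    rw [hv, edgeFlux]
    set N := (∫ s in y j..y (j + 1), (f s - k s))
      - (corrector y n (j + 1) * f2 (y (j + 1)) - corrector y n j * f2 (y j))
    rw [show N / hMid y j - c - hMid y j / 2 * f1 (y j)
      = (N - hMid y j * c - hMid y j ^ 2 / 2 * f1 (y j)) / hMid y j by field_simp,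
      abs_div, abs_of_pos hl, div_le_iff₀ hl]
    calc _ ≤ _ := key
      _ = _ := by ring
  have left : j ≠ 0 → |v i (j - 1) - c + hMid y (j - 1) / 2 * f1 (y j)| ≤ hMid y (j - 1) * E := by
    intro hj0
    obtain ⟨m, rfl⟩ := Nat.exists_eq_succ_of_ne_zero hj0
    simp only [Nat.succ_eq_add_one, Nat.add_sub_cancel] at *
    have hmn : m < n := hj
    have hl := hy.hMid_pos hmn
    have hd : y m - y (m + 1) = -hMid y m := by simp [hMid]
    have key := flux_expansion (hy.mem_unit hj) (hy.mem_unit (j := m) hmn.le) hf hk h1 h2 h3 h4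
      hk1 hM2 hM3 hM4 hK (hy.abs_corrector_le hj) hΛ0 hΛ
      (by rw [hd, abs_neg, abs_of_pos hl]; exact hMid_le_hmax hmn)
      (Pb := corrector y n m)
      (by have := corrector_succ_sub (x := y) (n := n) m; linear_combination -this)
    rw [hd, abs_neg, abs_of_pos hl, ← hc, ← hE, intervalIntegral.integral_symm] at key
    rw [hv, edgeFlux]
    set I := ∫ s in y m..y (m + 1), (f s - k s)
    rw [show (I - (corrector y n (m + 1) * f2 (y (m + 1)) - corrector y n m * f2 (y m))) / hMid y m
        - c + hMid y m / 2 * f1 (y (m + 1))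
      = -(-I - (corrector y n m * f2 (y m) - corrector y n (m + 1) * f2 (y (m + 1)))
        - (-hMid y m) * c - (-hMid y m) ^ 2 / 2 * f1 (y (m + 1))) / hMid y m by
          field_simp; ring,
      abs_div, abs_neg, abs_of_pos hl, div_le_iff₀ hl]
    calc _ ≤ _ := key
      _ = _ := by ring
  have hpos := hy.hNode_pos hj
  rcases eq_or_ne j 0 with rfl | hj0
  · have hc0 : c = 0 := by
      rw [hc, hy.1, hf0, hk0, corrector_zero hy]; ring
    have hr := right hn
    rw [hc0] at hr
    simp only [DyE, if_true]
    rw [show (v i 0 - 0) / hNode y n 0 - f1 (y 0)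
      = (v i 0 - 0 - hNode y n 0 * f1 (y 0)) / hNode y n 0 by field_simp,
      abs_div, abs_of_pos hpos, div_le_iff₀ hpos, hNode_zero]
    linarith
  · have hl := left hj0
    rcases eq_or_ne j n with rfl | hjn
    · have hc0 : c = 0 := by
        rw [hc, hy.2.1, hfn, hkn, corrector_last hy]; ring
      rw [hc0] at hl
      simp only [DyE, if_true, hj0, if_false]
      rw [show (0 - v i (j - 1)) / hNode y j j - f1 (y j)
        = -(v i (j - 1) - 0 + hNode y j j * f1 (y j)) / hNode y j j by field_simp; ring,
        abs_div, abs_of_pos hpos, div_le_iff₀ hpos, hNode_last hj0, abs_neg]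
      linarith
    · have hr := right (lt_of_le_of_ne hj hjn)
      simp only [DyE, hj0, hjn, if_false]
      rw [show (v i j - v i (j - 1)) / hNode y n j - f1 (y j)
        = (v i j - v i (j - 1) - hNode y n j * f1 (y j)) / hNode y n j by field_simp,
        abs_div, abs_of_pos hpos, div_le_iff₀ hpos, hNode_interior hj0 hjn]
      rw [abs_le] at *
      constructor <;> linarith [hl.1, hl.2, hr.1, hr.2]

lemma IsGrid.abs_corrector_mul_sub_le {y : ℕ → ℝ} {n j : ℕ} (hy : IsGrid y n) (hj : j < n)
    (h1 : |f (y (j + 1)) - f (y j)| ≤ M * hMid y j) (h2 : |f (y (j + 1))| ≤ M) :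
    |corrector y n (j + 1) * f (y (j + 1)) - corrector y n j * f (y j)|
      ≤ 3 * hmax y n ^ 2 * M * hMid y j := by
  have e : corrector y n (j + 1) * f (y (j + 1)) - corrector y n j * f (y j)
    = (corrector y n (j + 1) - corrector y n j) * f (y (j + 1))
      + corrector y n j * (f (y (j + 1)) - f (y j)) := by ring
  have hl := (hy.hMid_pos hj).le
  have hM0 := (abs_nonneg _).trans h2
  calc _ ≤ |corrector y n (j + 1) - corrector y n j| * |f (y (j + 1))|
      + |corrector y n j| * |f (y (j + 1)) - f (y j)| := by
        rw [e, ← abs_mul, ← abs_mul]; exact abs_add_le _ _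
    _ ≤ 2 * hmax y n ^ 2 * hMid y j * M + hmax y n ^ 2 * (M * hMid y j) := by
        have := hy.abs_corrector_succ_sub_le hj
        have := hy.abs_corrector_le hj.le
        gcongr
    _ = _ := by ring

lemma edgeFlux_sub_midpt {y : ℕ → ℝ} {n j : ℕ} (hy : IsGrid y n) (hj : j < n)
    (hf : Continuous f) (hk : Continuous k)
    (h1 : ∀ t ∈ Set.Icc (0 : ℝ) 1, HasDerivAt f (f1 t) t)
    (h2 : ∀ t ∈ Set.Icc (0 : ℝ) 1, HasDerivAt f1 (f2 t) t)
    (h3 : ∀ t ∈ Set.Icc (0 : ℝ) 1, HasDerivAt f2 (f3 t) t)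
    (hM2 : ∀ t ∈ Set.Icc (0 : ℝ) 1, |f2 t| ≤ M)
    (hM3 : ∀ t ∈ Set.Icc (0 : ℝ) 1, |f3 t| ≤ M)
    (hK : ∀ t ∈ Set.Icc (0 : ℝ) 1, |k t| ≤ K) :
    |edgeFlux y (corrector y n) (fun s => f s - k s) f2 j - f (midpt y j)|
      ≤ 4 * hmax y n ^ 2 * M + K := by
  have hl := hy.hMid_pos hj
  have ha := hy.mem_unit hj.le
  have hb := hy.mem_unit (j := j + 1) hj
  have hd : |y (j + 1) - y j| = hMid y j := abs_of_pos hl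
  have hM0 : 0 ≤ M := (abs_nonneg _).trans (hM2 _ ha)
  have e1 := integral_eq_midpoint hf ha hb h1 h2 hM2
  have e2 := abs_integral_le_of_unit (f := k) ha hb hK
  have e3 := taylor_one ha hb h3 hM3
  rw [hd] at e1 e2 e3
  have e4 := hy.abs_corrector_mul_sub_le hj e3 (hM2 _ hb)
  have e5 : M * hMid y j ^ 3 ≤ hmax y n ^ 2 * M * hMid y j := by
    have := hMid_le_hmax (x := y) hj
    calc M * hMid y j ^ 3 = hMid y j ^ 2 * M * hMid y j := by ring
      _ ≤ _ := by gcongr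
  have hint : (∫ s in y j..y (j + 1), (f s - k s))
      = (∫ s in y j..y (j + 1), f s) - ∫ s in y j..y (j + 1), k s :=
    intervalIntegral.integral_sub (hf.intervalIntegrable _ _) (hk.intervalIntegrable _ _)
  rw [edgeFlux, hint]
  set I1 := ∫ s in y j..y (j + 1), f s
  set I2 := ∫ s in y j..y (j + 1), k s
  set N := corrector y n (j + 1) * f2 (y (j + 1)) - corrector y n j * f2 (y j)
  rw [show (I1 - I2 - N) / hMid y j - f (midpt y j)
    = (I1 - I2 - N - hMid y j * f (midpt y j)) / hMid y j by field_simp, abs_div, abs_of_pos hl,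
    div_le_iff₀ hl]
  change |I1 - hMid y j * f (midpt y j)| ≤ _ at e1
  rw [abs_le] at *
  constructor <;> linarith [e1.1, e1.2, e2.1, e2.2, e4.1, e4.2]

/-- Consistency of the node difference quotient of the corrected midpoint values. -/
lemma corrected_midpt_quotient {x : ℕ → ℝ} {n i : ℕ} (hx : IsGrid x n) (h0 : i ≠ 0) (hi : i < n)
    (h1 : ∀ t ∈ Set.Icc (0 : ℝ) 1, HasDerivAt f (f1 t) t)
    (h2 : ∀ t ∈ Set.Icc (0 : ℝ) 1, HasDerivAt f1 (f2 t) t)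
    (h3 : ∀ t ∈ Set.Icc (0 : ℝ) 1, HasDerivAt f2 (f3 t) t)
    (hM : ∀ t ∈ Set.Icc (0 : ℝ) 1, |f3 t| ≤ M) :
    |((f (midpt x i) - hMid x i ^ 2 / 8 * f2 (midpt x i))
      - (f (midpt x (i - 1)) - hMid x (i - 1) ^ 2 / 8 * f2 (midpt x (i - 1)))) / hNode x n i
      - f1 (x i)| ≤ 2 * hmax x n ^ 2 * M := by
  have hpos := hx.hNode_pos hi.le
  obtain ⟨m, rfl⟩ := Nat.exists_eq_succ_of_ne_zero h0
  simp only [Nat.succ_eq_add_one, Nat.add_sub_cancel] at *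
  have ha := hx.mem_unit (j := m + 1) hi.le
  have hM0 : 0 ≤ M := (abs_nonneg _).trans (hM _ ha)
  have e1 := corrected_midpoint_expansion ha (hx.mem_unit (j := m + 1 + 1) hi) h1 h2 h3 hM
  have e2 := corrected_midpoint_expansion ha (hx.mem_unit (j := m) (by omega)) h1 h2 h3 hM
  have hp1 := hx.hMid_pos (i := m + 1) hi
  have hp2 := hx.hMid_pos (i := m) (by omega)
  have hq1 := hMid_le_hmax (x := x) (n := n) (i := m + 1) hi
  have hq2 := hMid_le_hmax (x := x) (n := n) (i := m) (by omega)
  rw [show x (m + 1 + 1) - x (m + 1) = hMid x (m + 1) from rfl, abs_of_pos hp1,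
    show (x (m + 1) + x (m + 1 + 1)) / 2 = midpt x (m + 1) from rfl] at e1
  rw [show x m - x (m + 1) = -hMid x m by simp [hMid], abs_neg, abs_of_pos hp2,
    show (x (m + 1) + x m) / 2 = midpt x m by simp [midpt, add_comm], neg_sq] at e2
  have b1 : M * hMid x (m + 1) ^ 3 ≤ hmax x n ^ 2 * M * hMid x (m + 1) := by
    calc _ = hMid x (m + 1) ^ 2 * M * hMid x (m + 1) := by ring
      _ ≤ _ := by gcongr
  have b2 : M * hMid x m ^ 3 ≤ hmax x n ^ 2 * M * hMid x m := by
    calc _ = hMid x m ^ 2 * M * hMid x m := by ring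
      _ ≤ _ := by gcongr
  set A := f (midpt x (m + 1)) - hMid x (m + 1) ^ 2 / 8 * f2 (midpt x (m + 1))
  set B := f (midpt x m) - hMid x m ^ 2 / 8 * f2 (midpt x m)
  rw [show (A - B) / hNode x n (m + 1) - f1 (x (m + 1))
    = (A - B - hNode x n (m + 1) * f1 (x (m + 1))) / hNode x n (m + 1) by field_simp,
    abs_div, abs_of_pos hpos, div_le_iff₀ hpos, hNode_interior h0 hi.ne]
  simp only [Nat.add_sub_cancel]
  rw [abs_le] at *
  constructor <;> linarith [e1.1, e1.2, e2.1, e2.2]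

end Consistency

/-! ### The discrete energy estimate -/

section Energy

variable {x y : ℕ → ℝ} {nx ny n : ℕ} {mu : ℝ}

lemma sum_Ico_backward_diff_mul (hn : 0 < n) (a e : ℕ → ℝ) (h0 : e 0 = 0) (h1 : e n = 0) :
    ∑ i ∈ Ico 1 n, (a i - a (i - 1)) * e i = -∑ i ∈ range n, a i * (e (i + 1) - e i) := by
  have A : ∑ i ∈ range n, a i * e i = ∑ i ∈ Ico 1 n, a i * e i := by
    rw [Finset.range_eq_Ico, Finset.sum_eq_sum_Ico_succ_bot hn, h0]; simp
  have B : ∑ i ∈ range n, a i * e (i + 1) = ∑ i ∈ Ico 1 n, a (i - 1) * e i := by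
    obtain ⟨m, rfl⟩ := Nat.exists_eq_succ_of_ne_zero hn.ne'
    rw [Nat.succ_eq_add_one] at h1 ⊢
    rw [Finset.sum_range_succ, h1, Finset.sum_Ico_eq_sum_range]
    simp [Nat.add_comm 1]
  simp only [sub_mul, mul_sub, Finset.sum_sub_distrib]
  rw [A, B]; ring

lemma sum_range_forward_diff_mul (hy : IsGrid y n) (Z : ℕ → ℝ) (v : ℕ → ℕ → ℝ) (i : ℕ) :
    ∑ j ∈ range n, (Z (j + 1) - Z j) * v i j
      = -∑ j ∈ range (n + 1),
          hNode y n j * (Z j * DyE y n v (fun _ => 0) (fun _ => 0) i j) := by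
  have hn := hy.pos
  have e0 : hNode y n 0 * (Z 0 * DyE y n v (fun _ => 0) (fun _ => 0) i 0) = Z 0 * v i 0 := by
    have := (hy.hNode_pos (Nat.zero_le n)).ne'
    simp only [DyE, if_true]
    field_simp
    ring
  have en : hNode y n n * (Z n * DyE y n v (fun _ => 0) (fun _ => 0) i n)
      = -(Z n * v i (n - 1)) := by
    have := (hy.hNode_pos le_rfl).ne'
    simp only [DyE, if_true, hn.ne', if_false]
    field_simp
    ring
  have ei : ∀ j ∈ Ico 1 n, hNode y n j * (Z j * DyE y n v (fun _ => 0) (fun _ => 0) i j)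
      = Z j * v i j - Z j * v i (j - 1) := by
    intro j hj
    rw [Finset.mem_Ico] at hj
    have := (hy.hNode_pos hj.2.le).ne'
    simp only [DyE, show j ≠ 0 by omega, show j ≠ n by omega, if_false]
    field_simp
  rw [sum_range_succ_eq_ends hn, e0, en, Finset.sum_congr rfl ei, Finset.sum_sub_distrib]
  have A : ∑ j ∈ range n, Z j * v i j = Z 0 * v i 0 + ∑ j ∈ Ico 1 n, Z j * v i j := by
    rw [Finset.range_eq_Ico, Finset.sum_eq_sum_Ico_succ_bot hn]
  have B : ∑ j ∈ range n, Z (j + 1) * v i j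
      = ∑ j ∈ Ico 1 n, Z j * v i (j - 1) + Z n * v i (n - 1) := by
    obtain ⟨m, rfl⟩ := Nat.exists_eq_succ_of_ne_zero hn.ne'
    rw [Nat.succ_eq_add_one, Finset.sum_range_succ, Finset.sum_Ico_eq_sum_range]
    simp [Nat.add_comm 1]
  simp only [sub_mul, Finset.sum_sub_distrib]
  rw [A, B]; ring

/-- Summation by parts for one component of the discrete momentum equation. -/
lemma momentum_summation_by_parts (hx : IsGrid x nx) (hy : IsGrid y ny) (e E Z : ℕ → ℕ → ℝ)
    (he : ∀ j < ny, e 0 j = 0 ∧ e nx j = 0) :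
    ∑ i ∈ Ico 1 nx, ∑ j ∈ range ny, hNode x nx i * hMid y j *
        (((E i j - E (i - 1) j) / hNode x nx i + (Z i (j + 1) - Z i j) / hMid y j) * e i j)
      = -(∑ i ∈ range nx, ∑ j ∈ range ny,
            hMid x i * hMid y j * (E i j * ((e (i + 1) j - e i j) / hMid x i)))
        - ∑ i ∈ range (nx + 1), ∑ j ∈ range (ny + 1), hNode x nx i * hNode y ny j *
            (Z i j * DyE y ny e (fun _ => 0) (fun _ => 0) i j) := by
  have hn := hx.pos
  have split : ∀ i ∈ Ico 1 nx, ∑ j ∈ range ny, hNode x nx i * hMid y j *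
        (((E i j - E (i - 1) j) / hNode x nx i + (Z i (j + 1) - Z i j) / hMid y j) * e i j)
      = ∑ j ∈ range ny, hMid y j * ((E i j - E (i - 1) j) * e i j)
        + hNode x nx i * ∑ j ∈ range ny, (Z i (j + 1) - Z i j) * e i j := by
    intro i hi
    rw [Finset.mem_Ico] at hi
    rw [Finset.mul_sum, ← Finset.sum_add_distrib]
    refine Finset.sum_congr rfl fun j hj => ?_
    have h1 := (hx.hNode_pos hi.2.le).ne'
    have h2 := (hy.hMid_pos (Finset.mem_range.1 hj)).ne'
    field_simp
  rw [Finset.sum_congr rfl split, Finset.sum_add_distrib, Finset.sum_comm]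
  have first : ∀ j ∈ range ny, ∑ i ∈ Ico 1 nx, hMid y j * ((E i j - E (i - 1) j) * e i j)
      = -∑ i ∈ range nx, hMid x i * hMid y j * (E i j * ((e (i + 1) j - e i j) / hMid x i)) := by
    intro j hj
    have hb := he j (Finset.mem_range.1 hj)
    rw [← Finset.mul_sum,
      sum_Ico_backward_diff_mul hn (fun i => E i j) (fun i => e i j) hb.1 hb.2, mul_neg,
      Finset.mul_sum]
    congr 1
    refine Finset.sum_congr rfl fun i hi => ?_
    have h1 := (hx.hMid_pos (Finset.mem_range.1 hi)).ne'
    field_simp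
  rw [Finset.sum_congr rfl first, Finset.sum_neg_distrib, Finset.sum_comm, sub_eq_add_neg]
  congr 1
  have vanish : ∀ i, (∀ j < ny, e i j = 0) → ∑ j ∈ range (ny + 1), hNode x nx i * hNode y ny j *
      (Z i j * DyE y ny e (fun _ => 0) (fun _ => 0) i j) = 0 := by
    intro i hi
    refine Finset.sum_eq_zero fun j hj => ?_
    have hj' := Finset.mem_range.1 hj
    have hn' := hy.pos
    have : DyE y ny e (fun _ => 0) (fun _ => 0) i j = 0 := by
      unfold DyE
      split_ifs with h0 h1
      · simp [hi 0 hn']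
      · simp [hi (ny - 1) (by omega)]
      · simp [hi j (by omega), hi (j - 1) (by omega)]
    simp [this]
  rw [sum_range_succ_eq_ends hn, vanish 0 fun j hj => (he j hj).1,
    vanish nx fun j hj => (he j hj).2, zero_add, add_zero, ← Finset.sum_neg_distrib]
  refine Finset.sum_congr rfl fun i _ => ?_
  rw [sum_range_forward_diff_mul hy (fun j => Z i j) e i, mul_neg, Finset.mul_sum]
  congr 1
  exact Finset.sum_congr rfl fun j _ => by ring

lemma sq_le_sum_diff_sq (hx : IsGrid x n) (e : ℕ → ℝ) (h0 : e 0 = 0) {i : ℕ} (hi : i ≤ n) :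
    e i ^ 2 ≤ ∑ k ∈ range n, hMid x k * ((e (k + 1) - e k) / hMid x k) ^ 2 := by
  have hsub : range i ⊆ range n := by simpa using hi
  have hp : ∀ k ∈ range n, 0 < hMid x k := fun k hk => hx.hMid_pos (Finset.mem_range.1 hk)
  have e1 : e i = ∑ k ∈ range i, hMid x k * ((e (k + 1) - e k) / hMid x k) := by
    rw [Finset.sum_congr rfl fun k hk => mul_div_cancel₀ _ (hp k (hsub hk)).ne',
      Finset.sum_range_sub, h0, sub_zero]
  have e2 := Finset.sum_sq_le_sum_mul_sum_of_sq_le_mul (range i)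
    (f := fun k => hMid x k) (g := fun k => hMid x k * ((e (k + 1) - e k) / hMid x k) ^ 2)
    (r := fun k => hMid x k * ((e (k + 1) - e k) / hMid x k))
    (fun k hk => (hp k (hsub hk)).le)
    (fun k hk => mul_nonneg (hp k (hsub hk)).le (sq_nonneg _)) fun k _ => le_of_eq (by ring)
  rw [← e1, hx.sum_hMid] at e2
  have e3 : 0 ≤ ∑ k ∈ range i, hMid x k * ((e (k + 1) - e k) / hMid x k) ^ 2 :=
    Finset.sum_nonneg fun k hk => mul_nonneg (hp k (hsub hk)).le (sq_nonneg _)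
  refine e2.trans ((mul_le_of_le_one_left e3 (hx.le_one hi)).trans ?_)
  exact Finset.sum_le_sum_of_subset_of_nonneg hsub
    fun k hk _ => mul_nonneg (hp k hk).le (sq_nonneg _)

lemma discrete_poincare (hx : IsGrid x nx) (hy : IsGrid y ny) (e : ℕ → ℕ → ℝ)
    (he : ∀ j < ny, e 0 j = 0) :
    ∑ i ∈ Ico 1 nx, ∑ j ∈ range ny, hNode x nx i * hMid y j * e i j ^ 2
      ≤ ∑ i ∈ range nx, ∑ j ∈ range ny,
          hMid x i * hMid y j * ((e (i + 1) j - e i j) / hMid x i) ^ 2 := by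
  rw [Finset.sum_comm, Finset.sum_comm (s := range nx)]
  refine Finset.sum_le_sum fun j hj => ?_
  have hj' := Finset.mem_range.1 hj
  have hl := (hy.hMid_pos hj').le
  set S := ∑ k ∈ range nx, hMid x k * ((e (k + 1) j - e k j) / hMid x k) ^ 2
  have hS : 0 ≤ S := Finset.sum_nonneg fun k hk =>
    mul_nonneg (hx.hMid_pos (Finset.mem_range.1 hk)).le (sq_nonneg _)
  calc ∑ i ∈ Ico 1 nx, hNode x nx i * hMid y j * e i j ^ 2
      ≤ ∑ i ∈ Ico 1 nx, hNode x nx i * (hMid y j * S) := by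
        refine Finset.sum_le_sum fun i hi => ?_
        rw [Finset.mem_Ico] at hi
        have h1 := (hx.hNode_pos hi.2.le).le
        have h2 := sq_le_sum_diff_sq hx (fun i => e i j) (he j hj') hi.2.le
        rw [mul_assoc]
        gcongr
    _ = (∑ i ∈ Ico 1 nx, hNode x nx i) * (hMid y j * S) := by rw [Finset.sum_mul]
    _ ≤ hMid y j * S :=
        mul_le_of_le_one_left (mul_nonneg hl hS) hx.sum_hNode_interior_le
    _ = _ := by
        rw [Finset.mul_sum]
        exact Finset.sum_congr rfl fun i _ => by ring

lemma cell_coercivity {nu t d X Y A B K : ℝ} (hmu : 0 < mu) (hnu : 0 < nu)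
    (hnm : nu * (2 * mu) ≤ 1) (hA : |A| ≤ K) (hB : |B| ≤ K)
    (hs : X + Y = nu * t + nu * A) (hd : X - Y = d / (2 * mu) + B) :
    mu / 4 * (X ^ 2 + Y ^ 2) - (1 / mu + mu) * K ^ 2
      ≤ (t + d) / 2 * X + (t - d) / 2 * Y := by
  have hA2 : A ^ 2 ≤ K ^ 2 := sq_le_sq.2 (hA.trans (le_abs_self K))
  have hB2 : B ^ 2 ≤ K ^ 2 := sq_le_sq.2 (hB.trans (le_abs_self K))
  set D := d / (2 * mu) with hD
  have hdD : d = 2 * mu * D := by rw [hD]; field_simp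
  have e1 : (t + d) / 2 * X + (t - d) / 2 * Y
      = nu / 2 * (t ^ 2 + t * A) + mu * (D ^ 2 + D * B) := by
    have : (t + d) / 2 * X + (t - d) / 2 * Y = t / 2 * (X + Y) + d / 2 * (X - Y) := by ring
    rw [this, hs, hd, hdD]; ring
  have e2 : X ^ 2 + Y ^ 2 = nu ^ 2 / 2 * (t + A) ^ 2 + (D + B) ^ 2 / 2 := by
    have : X ^ 2 + Y ^ 2 = ((X + Y) ^ 2 + (X - Y) ^ 2) / 2 := by ring
    rw [this, hs, hd]; ring
  have e3 : mu / 4 * (nu ^ 2 / 2 * (t + A) ^ 2) ≤ nu / 16 * (t + A) ^ 2 := by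
    have : mu / 4 * (nu ^ 2 / 2 * (t + A) ^ 2) = nu / 16 * (t + A) ^ 2 * (nu * (2 * mu)) := by ring
    rw [this]
    exact mul_le_of_le_one_right (by positivity) hnm
  have e4 : nu * K ^ 2 ≤ 1 / mu * K ^ 2 := by
    have : nu ≤ 1 / mu := by rw [le_div_iff₀ hmu]; nlinarith
    gcongr
  rw [e1, e2]
  have e5 : nu / 16 * (t + A) ^ 2 ≤ nu / 2 * (t ^ 2 + t * A) + nu * K ^ 2 := by
    have : 0 ≤ nu * (t ^ 2 / 2 + t * A / 2 + K ^ 2 - (t + A) ^ 2 / 16) :=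
      mul_nonneg hnu.le (by nlinarith [sq_nonneg (t + A), sq_nonneg (t + A / 2), hA2])
    linarith
  have e6 : mu / 8 * (D + B) ^ 2 ≤ mu * (D ^ 2 + D * B) + mu * K ^ 2 := by
    have : 0 ≤ mu * (D ^ 2 + D * B + K ^ 2 - (D + B) ^ 2 / 8) :=
      mul_nonneg hmu.le (by nlinarith [sq_nonneg (D + B), sq_nonneg (D + B / 2), hB2])
    linarith
  linarith

lemma node_coercivity {E sh S K : ℝ} (hmu : 0 < mu) (hS : |S| ≤ K) (hs : sh = E / mu - S) :
    E ^ 2 / (2 * mu) - mu / 2 * K ^ 2 ≤ E * sh := by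
  have hS2 : S ^ 2 ≤ K ^ 2 := sq_le_sq.2 (hS.trans (le_abs_self K))
  set F := E / mu with hF
  have hE : E = mu * F := by rw [hF]; field_simp
  have e : E ^ 2 / (2 * mu) = mu * F ^ 2 / 2 := by rw [hE]; field_simp
  rw [e, hs, hE]
  have : 0 ≤ mu * ((F - S) ^ 2 + (K ^ 2 - S ^ 2)) := mul_nonneg hmu.le (by nlinarith)
  linarith

lemma residual_young {R e K : ℝ} (hmu : 0 < mu) (hR : |R| ≤ K) :
    -(mu / 8 * e ^ 2 + 2 / mu * K ^ 2) ≤ R * e := by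
  have hR2 : R ^ 2 ≤ K ^ 2 := sq_le_sq.2 (hR.trans (le_abs_self K))
  have e1 : 0 ≤ 2 / mu * (R + mu / 4 * e) ^ 2 := by positivity
  have e2 : 2 / mu * (R + mu / 4 * e) ^ 2 = 2 / mu * R ^ 2 + R * e + mu / 8 * e ^ 2 := by
    field_simp; ring
  have e3 : 2 / mu * R ^ 2 ≤ 2 / mu * K ^ 2 := by gcongr
  linarith

lemma sum_sum_weights (s t : Finset ℕ) (a b : ℕ → ℝ) (c : ℝ) :
    ∑ i ∈ s, ∑ j ∈ t, a i * b j * c = (∑ i ∈ s, a i) * (∑ j ∈ t, b j) * c := by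
  rw [Finset.sum_mul_sum, Finset.sum_mul]
  exact Finset.sum_congr rfl fun i _ => by rw [Finset.sum_mul]

/-- Energy estimate for the discrete elasticity system with consistency errors bounded by `K`,
uniformly in the parameter `nu = 1 / (2 (lam + mu))`. -/
theorem discrete_energy_estimate (hmu : 0 < mu) {nu K : ℝ} (hnu : 0 < nu)
    (hnm : nu * (2 * mu) ≤ 1)
    (hx : IsGrid x nx) (hy : IsGrid y ny) (ex ey E11 E22 E12 : ℕ → ℕ → ℝ)
    (hex : ∀ j < ny, ex 0 j = 0 ∧ ex nx j = 0) (hey : ∀ i < nx, ey i 0 = 0 ∧ ey i ny = 0)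
    (hR1 : ∀ i, i ≠ 0 → i < nx → ∀ j < ny,
      |(E11 i j - E11 (i - 1) j) / hNode x nx i + (E12 i (j + 1) - E12 i j) / hMid y j| ≤ K)
    (hR2 : ∀ i < nx, ∀ j, j ≠ 0 → j < ny →
      |(E22 i j - E22 i (j - 1)) / hNode y ny j + (E12 (i + 1) j - E12 i j) / hMid x i| ≤ K)
    (hA : ∀ i < nx, ∀ j < ny,
      |(ex (i + 1) j - ex i j) / hMid x i + (ey i (j + 1) - ey i j) / hMid y j
        - nu * (E11 i j + E22 i j)| ≤ nu * K)
    (hB : ∀ i < nx, ∀ j < ny,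
      |(ex (i + 1) j - ex i j) / hMid x i - (ey i (j + 1) - ey i j) / hMid y j
        - (E11 i j - E22 i j) / (2 * mu)| ≤ K)
    (hS : ∀ i ≤ nx, ∀ j ≤ ny,
      |E12 i j / mu - (DyE y ny ex (fun _ => 0) (fun _ => 0) i j
        + DxE x nx ey (fun _ => 0) (fun _ => 0) i j)| ≤ K) :
    ∑ i ∈ Ico 1 nx, ∑ j ∈ range ny, hNode x nx i * hMid y j * ex i j ^ 2
        ≤ (40 / mu ^ 2 + 16) * K ^ 2 ∧
      ∑ i ∈ range nx, ∑ j ∈ Ico 1 ny, hMid x i * hNode y ny j * ey i j ^ 2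
        ≤ (40 / mu ^ 2 + 16) * K ^ 2 ∧
      ∑ i ∈ range (nx + 1), ∑ j ∈ range (ny + 1), hNode x nx i * hNode y ny j * E12 i j ^ 2
        ≤ (10 + 4 * mu ^ 2) * K ^ 2 := by
  have wx : ∀ i ∈ range nx, 0 < hMid x i := fun i hi => hx.hMid_pos (Finset.mem_range.1 hi)
  have wy : ∀ j ∈ range ny, 0 < hMid y j := fun j hj => hy.hMid_pos (Finset.mem_range.1 hj)
  have vx : ∀ i ≤ nx, 0 < hNode x nx i := fun i hi => hx.hNode_pos hi
  have vy : ∀ j ≤ ny, 0 < hNode y ny j := fun j hj => hy.hNode_pos hj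
  have I1 := momentum_summation_by_parts hx hy ex E11 E12 hex
  have I2 := momentum_summation_by_parts hy hx (fun j i => ey i j) (fun j i => E22 i j)
    (fun j i => E12 i j) hey
  have P1 := discrete_poincare hx hy ex (fun j hj => (hex j hj).1)
  have P2 := discrete_poincare hy hx (fun j i => ey i j) (fun i hi => (hey i hi).1)
  rw [Finset.sum_comm, Finset.sum_comm (s := range ny), Finset.sum_comm (s := range (ny + 1))]
    at I2
  rw [Finset.sum_comm, Finset.sum_comm (s := range ny)] at P2
  set Sx := ∑ i ∈ Ico 1 nx, ∑ j ∈ range ny, hNode x nx i * hMid y j * ex i j ^ 2 with hSx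
  set Sy := ∑ i ∈ range nx, ∑ j ∈ Ico 1 ny, hMid x i * hNode y ny j * ey i j ^ 2 with hSy
  set SE := ∑ i ∈ range (nx + 1), ∑ j ∈ range (ny + 1), hNode x nx i * hNode y ny j * E12 i j ^ 2
    with hSE
  have hSy' : ∑ i ∈ range nx, ∑ j ∈ Ico 1 ny, hNode y ny j * hMid x i * ey i j ^ 2 = Sy :=
    Finset.sum_congr rfl fun i _ => Finset.sum_congr rfl fun j _ => by ring
  rw [hSy'] at P2
  have L1 : -(mu / 8 * Sx + 2 / mu * K ^ 2) ≤
      ∑ i ∈ Ico 1 nx, ∑ j ∈ range ny, hNode x nx i * hMid y j *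
        (((E11 i j - E11 (i - 1) j) / hNode x nx i + (E12 i (j + 1) - E12 i j) / hMid y j)
          * ex i j) := by
    have hw : (∑ i ∈ Ico 1 nx, hNode x nx i) * (∑ j ∈ range ny, hMid y j) * (2 / mu * K ^ 2)
        ≤ 2 / mu * K ^ 2 := by
      rw [hy.sum_hMid, hy.2.1, mul_one]
      exact mul_le_of_le_one_left (by positivity) hx.sum_hNode_interior_le
    rw [← sum_sum_weights] at hw
    calc -(mu / 8 * Sx + 2 / mu * K ^ 2)
        ≤ -(mu / 8 * Sx
          + ∑ i ∈ Ico 1 nx, ∑ j ∈ range ny, hNode x nx i * hMid y j * (2 / mu * K ^ 2)) := by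
          linarith
      _ = ∑ i ∈ Ico 1 nx, ∑ j ∈ range ny, hNode x nx i * hMid y j *
            -(mu / 8 * ex i j ^ 2 + 2 / mu * K ^ 2) := by
          rw [hSx, Finset.mul_sum, ← Finset.sum_add_distrib, ← Finset.sum_neg_distrib]
          refine Finset.sum_congr rfl fun i _ => ?_
          rw [Finset.mul_sum, ← Finset.sum_add_distrib, ← Finset.sum_neg_distrib]
          exact Finset.sum_congr rfl fun j _ => by ring
      _ ≤ _ := by
          refine Finset.sum_le_sum fun i hi => Finset.sum_le_sum fun j hj => ?_
          rw [Finset.mem_Ico] at hi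
          exact mul_le_mul_of_nonneg_left
            (residual_young hmu (hR1 i (by omega) hi.2 j (Finset.mem_range.1 hj)))
            (mul_pos (vx i hi.2.le) (wy j hj)).le
  have L2 : -(mu / 8 * Sy + 2 / mu * K ^ 2) ≤
      ∑ i ∈ range nx, ∑ j ∈ Ico 1 ny, hNode y ny j * hMid x i *
        (((E22 i j - E22 i (j - 1)) / hNode y ny j + (E12 (i + 1) j - E12 i j) / hMid x i)
          * ey i j) := by
    have hw : (∑ i ∈ range nx, hMid x i) * (∑ j ∈ Ico 1 ny, hNode y ny j) * (2 / mu * K ^ 2)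
        ≤ 2 / mu * K ^ 2 := by
      rw [hx.sum_hMid, hx.2.1, one_mul]
      exact mul_le_of_le_one_left (by positivity) hy.sum_hNode_interior_le
    rw [← sum_sum_weights] at hw
    calc -(mu / 8 * Sy + 2 / mu * K ^ 2)
        ≤ -(mu / 8 * Sy
          + ∑ i ∈ range nx, ∑ j ∈ Ico 1 ny, hMid x i * hNode y ny j * (2 / mu * K ^ 2)) := by
          linarith
      _ = ∑ i ∈ range nx, ∑ j ∈ Ico 1 ny, hNode y ny j * hMid x i *
            -(mu / 8 * ey i j ^ 2 + 2 / mu * K ^ 2) := by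
          rw [hSy, Finset.mul_sum, ← Finset.sum_add_distrib, ← Finset.sum_neg_distrib]
          refine Finset.sum_congr rfl fun i _ => ?_
          rw [Finset.mul_sum, ← Finset.sum_add_distrib, ← Finset.sum_neg_distrib]
          exact Finset.sum_congr rfl fun j _ => by ring
      _ ≤ _ := by
          refine Finset.sum_le_sum fun i hi => Finset.sum_le_sum fun j hj => ?_
          rw [Finset.mem_Ico] at hj
          exact mul_le_mul_of_nonneg_left
            (residual_young hmu (hR2 i (Finset.mem_range.1 hi) j (by omega) hj.2))
            (mul_pos (vy j hj.2.le) (wx i hi)).le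
  set X := fun i j => (ex (i + 1) j - ex i j) / hMid x i with hX
  set Y := fun i j => (ey i (j + 1) - ey i j) / hMid y j with hY
  set SX := ∑ i ∈ range nx, ∑ j ∈ range ny, hMid x i * hMid y j * X i j ^ 2 with hSX
  set SY := ∑ i ∈ range nx, ∑ j ∈ range ny, hMid x i * hMid y j * Y i j ^ 2 with hSY
  have hSY' : ∑ i ∈ range nx, ∑ j ∈ range ny, hMid y j * hMid x i * Y i j ^ 2 = SY :=
    Finset.sum_congr rfl fun i _ => Finset.sum_congr rfl fun j _ => by ring
  have P2' : Sy ≤ SY := hSY' ▸ P2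
  have P1' : Sx ≤ SX := P1
  have L3 : mu / 4 * (SX + SY) - (1 / mu + mu) * K ^ 2
      ≤ (∑ i ∈ range nx, ∑ j ∈ range ny, hMid x i * hMid y j * (E11 i j * X i j))
        + ∑ i ∈ range nx, ∑ j ∈ range ny, hMid y j * hMid x i * (E22 i j * Y i j) := by
    have hw : (∑ i ∈ range nx, hMid x i) * (∑ j ∈ range ny, hMid y j) * ((1 / mu + mu) * K ^ 2)
        = (1 / mu + mu) * K ^ 2 := by
      rw [hx.sum_hMid, hx.2.1, hy.sum_hMid, hy.2.1]; ring
    rw [← sum_sum_weights] at hw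
    calc mu / 4 * (SX + SY) - (1 / mu + mu) * K ^ 2
        = mu / 4 * (SX + SY) - ∑ i ∈ range nx, ∑ j ∈ range ny, hMid x i * hMid y j *
            ((1 / mu + mu) * K ^ 2) := by rw [hw]
      _ = ∑ i ∈ range nx, ∑ j ∈ range ny, hMid x i * hMid y j *
            (mu / 4 * (X i j ^ 2 + Y i j ^ 2) - (1 / mu + mu) * K ^ 2) := by
          rw [hSX, hSY, ← Finset.sum_add_distrib, Finset.mul_sum, ← Finset.sum_sub_distrib]
          refine Finset.sum_congr rfl fun i _ => ?_
          rw [← Finset.sum_add_distrib, Finset.mul_sum, ← Finset.sum_sub_distrib]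
          exact Finset.sum_congr rfl fun j _ => by ring
      _ ≤ ∑ i ∈ range nx, ∑ j ∈ range ny, hMid x i * hMid y j *
            (E11 i j * X i j + E22 i j * Y i j) := by
          refine Finset.sum_le_sum fun i hi => Finset.sum_le_sum fun j hj => ?_
          refine mul_le_mul_of_nonneg_left ?_ (mul_pos (wx i hi) (wy j hj)).le
          have hA' := hA i (Finset.mem_range.1 hi) j (Finset.mem_range.1 hj)
          have hB' := hB i (Finset.mem_range.1 hi) j (Finset.mem_range.1 hj)
          have key := cell_coercivity (t := E11 i j + E22 i j) (d := E11 i j - E22 i j)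
            (X := X i j) (Y := Y i j)
            (A := (X i j + Y i j - nu * (E11 i j + E22 i j)) / nu) hmu hnu hnm
            (by rw [abs_div, abs_of_pos hnu, div_le_iff₀ hnu, mul_comm K]; exact hA')
            hB' (by field_simp; ring) (by ring)
          calc _ ≤ _ := key
            _ = _ := by ring
      _ = _ := by
          rw [← Finset.sum_add_distrib]
          refine Finset.sum_congr rfl fun i _ => ?_
          rw [← Finset.sum_add_distrib]
          exact Finset.sum_congr rfl fun j _ => by ring
  have L4 : SE / (2 * mu) - mu / 2 * K ^ 2
      ≤ (∑ i ∈ range (nx + 1), ∑ j ∈ range (ny + 1), hNode x nx i * hNode y ny j *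
            (E12 i j * DyE y ny ex (fun _ => 0) (fun _ => 0) i j))
        + ∑ i ∈ range (nx + 1), ∑ j ∈ range (ny + 1), hNode y ny j * hNode x nx i *
            (E12 i j * DyE x nx (fun j i => ey i j) (fun _ => 0) (fun _ => 0) j i) := by
    have hw : (∑ i ∈ range (nx + 1), hNode x nx i) * (∑ j ∈ range (ny + 1), hNode y ny j)
        * (mu / 2 * K ^ 2) = mu / 2 * K ^ 2 := by
      rw [hx.sum_hNode, hy.sum_hNode]; ring
    rw [← sum_sum_weights] at hw
    calc SE / (2 * mu) - mu / 2 * K ^ 2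
        = SE / (2 * mu) - ∑ i ∈ range (nx + 1), ∑ j ∈ range (ny + 1),
            hNode x nx i * hNode y ny j * (mu / 2 * K ^ 2) := by rw [hw]
      _ = ∑ i ∈ range (nx + 1), ∑ j ∈ range (ny + 1), hNode x nx i * hNode y ny j *
            (E12 i j ^ 2 / (2 * mu) - mu / 2 * K ^ 2) := by
          rw [hSE, Finset.sum_div, ← Finset.sum_sub_distrib]
          refine Finset.sum_congr rfl fun i _ => ?_
          rw [Finset.sum_div, ← Finset.sum_sub_distrib]
          exact Finset.sum_congr rfl fun j _ => by ring
      _ ≤ ∑ i ∈ range (nx + 1), ∑ j ∈ range (ny + 1), hNode x nx i * hNode y ny j *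
            (E12 i j * (DyE y ny ex (fun _ => 0) (fun _ => 0) i j
              + DxE x nx ey (fun _ => 0) (fun _ => 0) i j)) := by
          refine Finset.sum_le_sum fun i hi => Finset.sum_le_sum fun j hj => ?_
          have hi' := Nat.lt_succ_iff.1 (Finset.mem_range.1 hi)
          have hj' := Nat.lt_succ_iff.1 (Finset.mem_range.1 hj)
          exact mul_le_mul_of_nonneg_left
            (node_coercivity hmu (hS i hi' j hj') (by ring)) (mul_pos (vx i hi') (vy j hj')).le
      _ = _ := by
          rw [← Finset.sum_add_distrib]
          refine Finset.sum_congr rfl fun i _ => ?_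
          rw [← Finset.sum_add_distrib]
          refine Finset.sum_congr rfl fun j _ => ?_
          have : DxE x nx ey (fun _ => 0) (fun _ => 0) i j
            = DyE x nx (fun j i => ey i j) (fun _ => 0) (fun _ => 0) j i := rfl
          rw [this]; ring
  have total : mu / 8 * (SX + SY) + SE / (2 * mu) ≤ (5 / mu + 2 * mu) * K ^ 2 := by
    have q1 : mu / 8 * Sx ≤ mu / 8 * SX := by gcongr
    have q2 : mu / 8 * Sy ≤ mu / 8 * SY := by gcongr
    have q3 : (5 / mu + 2 * mu) * K ^ 2
      = (1 / mu + mu) * K ^ 2 + mu / 2 * K ^ 2 + 2 / mu * K ^ 2 + 2 / mu * K ^ 2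
        + mu / 2 * K ^ 2 := by ring
    have q4 : 0 ≤ mu / 2 * K ^ 2 := by positivity
    rw [I1] at L1
    rw [I2] at L2
    linarith
  have hSX0 : 0 ≤ SX := Finset.sum_nonneg fun i hi => Finset.sum_nonneg fun j hj =>
    mul_nonneg (mul_pos (wx i hi) (wy j hj)).le (sq_nonneg _)
  have hSY0 : 0 ≤ SY := Finset.sum_nonneg fun i hi => Finset.sum_nonneg fun j hj =>
    mul_nonneg (mul_pos (wx i hi) (wy j hj)).le (sq_nonneg _)
  have hSE0 : 0 ≤ SE := Finset.sum_nonneg fun i hi => Finset.sum_nonneg fun j hj =>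
    mul_nonneg (mul_pos (vx i (Nat.lt_succ_iff.1 (Finset.mem_range.1 hi)))
      (vy j (Nat.lt_succ_iff.1 (Finset.mem_range.1 hj)))).le (sq_nonneg _)
  have hSE1 : 0 ≤ SE / (2 * mu) := by positivity
  have bound : SX + SY ≤ (40 / mu ^ 2 + 16) * K ^ 2 := by
    have : mu / 8 * (SX + SY) ≤ mu / 8 * ((40 / mu ^ 2 + 16) * K ^ 2) := by
      have q : mu / 8 * ((40 / mu ^ 2 + 16) * K ^ 2) = (5 / mu + 2 * mu) * K ^ 2 := by
        field_simp; ring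
      rw [q]; linarith
    exact le_of_mul_le_mul_left this (by positivity)
  refine ⟨by linarith, by linarith, ?_⟩
  have q : 0 ≤ mu / 8 * (SX + SY) := by positivity
  have q1 : SE / (2 * mu) ≤ (5 / mu + 2 * mu) * K ^ 2 := by linarith
  rw [div_le_iff₀ (by positivity)] at q1
  calc SE ≤ _ := q1
    _ = _ := by field_simp; ring

end Energy

/-! ### Functions with bounded derivatives on the unit square -/

section Smooth

/-- `F` is of class `C^n`, with derivatives of order at most `n` bounded by `M` on `[0,1]²`. -/
def BoundedC (n : ℕ) (F : ℝ × ℝ → ℝ) (M : ℝ) : Prop :=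
  ContDiff ℝ n F ∧ ∀ p ∈ Set.Icc ((0 : ℝ), (0 : ℝ)) ((1 : ℝ), (1 : ℝ)), ∀ k ≤ n,
    ‖iteratedFDeriv ℝ k F p‖ ≤ M

variable {F G : ℝ × ℝ → ℝ} {M M' a b : ℝ} {m n : ℕ}

lemma mem_unitSquare (ha : a ∈ Set.Icc (0 : ℝ) 1) (hb : b ∈ Set.Icc (0 : ℝ) 1) :
    (a, b) ∈ Set.Icc ((0 : ℝ), (0 : ℝ)) ((1 : ℝ), (1 : ℝ)) :=
  ⟨⟨ha.1, hb.1⟩, ⟨ha.2, hb.2⟩⟩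

lemma hasDerivAt_pdx (hF : ContDiff ℝ 1 F) (a b : ℝ) :
    HasDerivAt (fun t => F (t, b)) (pdx F (a, b)) a := by
  have h : DifferentiableAt ℝ (fun t => F (t, b)) a :=
    ((hF.differentiable one_ne_zero).comp (by fun_prop : Differentiable ℝ fun t : ℝ => (t, b))) a
  exact h.hasDerivAt

lemma hasDerivAt_pdy (hF : ContDiff ℝ 1 F) (a b : ℝ) :
    HasDerivAt (fun t => F (a, t)) (pdy F (a, b)) b := by
  have h : DifferentiableAt ℝ (fun t => F (a, t)) b :=
    ((hF.differentiable one_ne_zero).comp (by fun_prop : Differentiable ℝ fun t : ℝ => (a, t))) b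
  exact h.hasDerivAt

lemma pdx_eq_fderiv (hF : ContDiff ℝ 1 F) : pdx F = fun p => fderiv ℝ F p (1, 0) := by
  funext p
  have h := (hF.differentiable one_ne_zero p).hasFDerivAt.comp_hasDerivAt p.1
    ((hasDerivAt_id p.1).prodMk (hasDerivAt_const p.1 p.2))
  exact h.deriv

lemma pdy_eq_fderiv (hF : ContDiff ℝ 1 F) : pdy F = fun p => fderiv ℝ F p (0, 1) := by
  funext p
  have h := (hF.differentiable one_ne_zero p).hasFDerivAt.comp_hasDerivAt p.2
    ((hasDerivAt_const p.2 p.1).prodMk (hasDerivAt_id p.2))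
  exact h.deriv

lemma ContDiff.pdx (hF : ContDiff ℝ (n + 1 : ℕ) F) : ContDiff ℝ n (pdx F) := by
  rw [pdx_eq_fderiv (hF.of_le (by exact_mod_cast Nat.le_add_left 1 n))]
  exact (hF.fderiv_right (by push_cast; rfl)).clm_apply contDiff_const

lemma ContDiff.pdy (hF : ContDiff ℝ (n + 1 : ℕ) F) : ContDiff ℝ n (pdy F) := by
  rw [pdy_eq_fderiv (hF.of_le (by exact_mod_cast Nat.le_add_left 1 n))]
  exact (hF.fderiv_right (by push_cast; rfl)).clm_apply contDiff_const

lemma pdx_pdy_comm (hF : ContDiff ℝ 2 F) : pdx (pdy F) = pdy (pdx F) := by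
  have h1 : ContDiff ℝ 1 F := hF.of_le (by norm_num)
  have hx : ContDiff ℝ 1 (pdx F) := ContDiff.pdx (n := 1) hF
  have hy : ContDiff ℝ 1 (pdy F) := ContDiff.pdy (n := 1) hF
  have hd : Differentiable ℝ (fderiv ℝ F) :=
    (hF.fderiv_right (m := 1) (by norm_num)).differentiable one_ne_zero
  rw [pdx_eq_fderiv hy, pdy_eq_fderiv hx]
  funext p
  have e1 : fderiv ℝ (pdx F) p (0, 1) = fderiv ℝ (fderiv ℝ F) p (0, 1) (1, 0) := by
    rw [pdx_eq_fderiv h1, fderiv_clm_apply (hd p) (differentiableAt_const _)]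
    simp
  have e2 : fderiv ℝ (pdy F) p (1, 0) = fderiv ℝ (fderiv ℝ F) p (1, 0) (0, 1) := by
    rw [pdy_eq_fderiv h1, fderiv_clm_apply (hd p) (differentiableAt_const _)]
    simp
  have hs : IsSymmSndFDerivAt ℝ F p :=
    hF.contDiffAt.isSymmSndFDerivAt (by simp)
  rw [e1, e2, hs.eq]

namespace BoundedC

lemma abs_le (hF : BoundedC n F M) (ha : a ∈ Set.Icc (0 : ℝ) 1) (hb : b ∈ Set.Icc (0 : ℝ) 1) :
    |F (a, b)| ≤ M := by
  simpa using hF.2 _ (mem_unitSquare ha hb) 0 (Nat.zero_le n)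

lemma nonneg (hF : BoundedC n F M) : 0 ≤ M :=
  (abs_nonneg _).trans (hF.abs_le (a := 0) (b := 0) (by simp) (by simp))

lemma continuous (hF : BoundedC n F M) : Continuous F := hF.1.continuous

lemma mono (hF : BoundedC n F M) (h : M ≤ M') : BoundedC n F M' :=
  ⟨hF.1, fun p hp k hk => (hF.2 p hp k hk).trans h⟩

lemma of_le (hF : BoundedC n F M) (h : m ≤ n) : BoundedC m F M :=
  ⟨hF.1.of_le (by exact_mod_cast h), fun p hp k hk => hF.2 p hp k (hk.trans h)⟩

lemma contDiff_one (hF : BoundedC (n + 1) F M) : ContDiff ℝ 1 F :=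
  hF.1.of_le (by exact_mod_cast Nat.le_add_left 1 n)

lemma fderiv_apply (hF : BoundedC (n + 1) F M) {v : ℝ × ℝ} (hv : ‖v‖ ≤ 1) :
    BoundedC n (fun p => fderiv ℝ F p v) M := by
  have hd : ContDiff ℝ n (fderiv ℝ F) := hF.1.fderiv_right (by push_cast; rfl)
  refine ⟨hd.clm_apply contDiff_const, fun p hp k hk => ?_⟩
  have h := norm_iteratedFDeriv_clm_apply_const (c := v) (x := p) (n := k) hd.contDiffAt
    (by exact_mod_cast hk)
  rw [norm_iteratedFDeriv_fderiv] at h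
  have h2 := hF.2 p hp (k + 1) (by omega)
  calc _ ≤ _ := h
    _ ≤ 1 * M := by gcongr
    _ = M := one_mul M

lemma pdx (hF : BoundedC (n + 1) F M) : BoundedC n (pdx F) M := by
  rw [pdx_eq_fderiv hF.contDiff_one]
  exact hF.fderiv_apply (by simp [Prod.norm_def])

lemma pdy (hF : BoundedC (n + 1) F M) : BoundedC n (pdy F) M := by
  rw [pdy_eq_fderiv hF.contDiff_one]
  exact hF.fderiv_apply (by simp [Prod.norm_def])

lemma add (hF : BoundedC n F M) (hG : BoundedC n G M') :
    BoundedC n (fun p => F p + G p) (M + M') := by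
  refine ⟨hF.1.add hG.1, fun p hp k hk => ?_⟩
  have h := iteratedFDeriv_add_apply (x := p)
    (hF.1.contDiffAt.of_le (m := k) (by exact_mod_cast hk))
    (hG.1.contDiffAt.of_le (m := k) (by exact_mod_cast hk))
  change ‖iteratedFDeriv ℝ k (F + G) p‖ ≤ _
  rw [h]
  exact (norm_add_le _ _).trans (add_le_add (hF.2 p hp k hk) (hG.2 p hp k hk))

lemma const_mul (hF : BoundedC n F M) (c : ℝ) : BoundedC n (fun p => c * F p) (|c| * M) := by
  refine ⟨contDiff_const.mul hF.1, fun p hp k hk => ?_⟩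
  have h := iteratedFDeriv_const_smul_apply (x := p) (a := c)
    (hF.1.contDiffAt.of_le (m := k) (by exact_mod_cast hk))
  change ‖iteratedFDeriv ℝ k (c • F) p‖ ≤ _
  rw [h, norm_smul, Real.norm_eq_abs]
  exact mul_le_mul_of_nonneg_left (hF.2 p hp k hk) (abs_nonneg c)

lemma swap (hF : BoundedC n F M) : BoundedC n (fun p => F p.swap) M := by
  refine ⟨hF.1.comp (contDiff_snd.prodMk contDiff_fst), fun p hp k hk => ?_⟩
  have h := (LinearIsometryEquiv.mk (ContinuousLinearEquiv.prodComm ℝ ℝ ℝ).toLinearEquiv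
    (fun p => by simp [Prod.norm_def, max_comm])).norm_iteratedFDeriv_comp_right F p k
  calc _ = _ := h
    _ ≤ M := hF.2 _ (mem_unitSquare ⟨hp.1.2, hp.2.2⟩ ⟨hp.1.1, hp.2.1⟩) k hk

lemma hasDerivAt_x (hF : BoundedC (n + 1) F M) (a b : ℝ) :
    HasDerivAt (fun t => F (t, b)) (_root_.pdx F (a, b)) a := hasDerivAt_pdx hF.contDiff_one a b

lemma hasDerivAt_y (hF : BoundedC (n + 1) F M) (a b : ℝ) :
    HasDerivAt (fun t => F (a, t)) (_root_.pdy F (a, b)) b := hasDerivAt_pdy hF.contDiff_one a b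

end BoundedC

lemma boundedC_norm3 (hF : ContDiff ℝ 3 F) : BoundedC 3 F (norm3 F) := by
  refine ⟨hF, fun p hp k hk => ?_⟩
  have hc : ∀ k : Fin 4, ∃ B, ∀ p ∈ Set.Icc ((0 : ℝ), (0 : ℝ)) ((1 : ℝ), (1 : ℝ)),
      ‖iteratedFDeriv ℝ (k : ℕ) F p‖ ≤ B := fun k =>
    isCompact_Icc.exists_bound_of_continuousOn
      (hF.continuous_iteratedFDeriv (by exact_mod_cast Nat.lt_succ_iff.1 k.2)).continuousOn
  choose B hB using hc
  have hbdd : BddAbove (Set.range fun p : Set.Icc ((0 : ℝ), (0 : ℝ)) ((1 : ℝ), (1 : ℝ)) =>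
      ⨆ k : Fin 4, ‖iteratedFDeriv ℝ (k : ℕ) F (p : ℝ × ℝ)‖) := by
    refine ⟨⨆ k, B k, ?_⟩
    rintro _ ⟨p, rfl⟩
    exact ciSup_mono (Set.finite_range _).bddAbove fun k => hB k p p.2
  calc ‖iteratedFDeriv ℝ k F p‖
      ≤ ⨆ k : Fin 4, ‖iteratedFDeriv ℝ (k : ℕ) F p‖ :=
        le_ciSup (f := fun k : Fin 4 => ‖iteratedFDeriv ℝ (k : ℕ) F p‖)
          (Set.finite_range _).bddAbove ⟨k, by omega⟩
    _ ≤ norm3 F := le_ciSup hbdd ⟨p, hp⟩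

end Smooth

/-! ### The cell functional and the discrete lifting -/

section CellFunctional

variable {x y : ℕ → ℝ} {nx ny i j : ℕ} {w w' : ℝ × ℝ → ℝ} {M M' : ℝ}

/-- The jump over the cell `(x_i, x_{i+1})` of `corrector · ∫ ∂_x² w dy`. -/
def cellJump (x y : ℕ → ℝ) (nx i j : ℕ) (w : ℝ × ℝ → ℝ) : ℝ :=
  corrector x nx (i + 1) * (∫ s in y j..y (j + 1), pdx (pdx w) (x (i + 1), s))
    - corrector x nx i * ∫ s in y j..y (j + 1), pdx (pdx w) (x i, s)

/-- The cell integral of `w` with the corrector jumps in both directions removed. -/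
def cellFunctional (x y : ℕ → ℝ) (nx ny i j : ℕ) (w : ℝ × ℝ → ℝ) : ℝ :=
  (∫ s in y j..y (j + 1), ∫ t in x i..x (i + 1), w (t, s))
    - cellJump x y nx i j w - cellJump y x ny j i fun p => w p.swap

lemma integral_cell_swap (hw : Continuous w) (a b c d : ℝ) :
    ∫ s in c..d, ∫ t in a..b, w (t, s) = ∫ t in a..b, ∫ s in c..d, w (t, s) := by
  refine MeasureTheory.intervalIntegral_intervalIntegral_swap (F := fun s t => w (t, s)) ?_
  have hc : Continuous (Function.uncurry fun s t => w (t, s)) :=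
    hw.comp (continuous_snd.prodMk continuous_fst)
  refine (hc.continuousOn.integrableOn_compact
    (isCompact_uIcc.prod isCompact_uIcc)).mono_set
    (Set.prod_mono Set.uIoc_subset_uIcc Set.uIoc_subset_uIcc)

lemma continuous_integral_x (hw : Continuous w) (a b : ℝ) :
    Continuous fun s => ∫ t in a..b, w (t, s) :=
  intervalIntegral.continuous_parametric_intervalIntegral_of_continuous'
    (f := fun s t => w (t, s)) (hw.comp (continuous_snd.prodMk continuous_fst)) a b

lemma cellFunctional_swap (hw : Continuous w) :
    cellFunctional x y nx ny i j (fun p => w p.swap) = cellFunctional y x ny nx j i w := by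
  have h := integral_cell_swap hw (y j) (y (j + 1)) (x i) (x (i + 1))
  simp only [cellFunctional, Prod.swap_swap, Prod.swap_prod_mk]
  rw [h]; ring

lemma pdx_add (hw : ContDiff ℝ 1 w) (hw' : ContDiff ℝ 1 w') :
    pdx (fun p => w p + w' p) = fun p => pdx w p + pdx w' p := by
  funext ⟨a, b⟩
  exact ((hasDerivAt_pdx hw a b).add (hasDerivAt_pdx hw' a b)).deriv

lemma cellJump_add (hw : BoundedC 2 w M) (hw' : BoundedC 2 w' M') :
    cellJump x y nx i j (fun p => w p + w' p)
      = cellJump x y nx i j w + cellJump x y nx i j w' := by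
  have hi : ∀ a, ∫ s in y j..y (j + 1), pdx (pdx fun p => w p + w' p) (a, s)
      = (∫ s in y j..y (j + 1), pdx (pdx w) (a, s))
        + ∫ s in y j..y (j + 1), pdx (pdx w') (a, s) := by
    intro a
    rw [pdx_add hw.contDiff_one hw'.contDiff_one,
      pdx_add hw.pdx.contDiff_one hw'.pdx.contDiff_one]
    exact intervalIntegral.integral_add
      ((hw.pdx.pdx.continuous.comp (Continuous.prodMk_right a)).intervalIntegrable _ _)
      ((hw'.pdx.pdx.continuous.comp (Continuous.prodMk_right a)).intervalIntegrable _ _)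
  simp only [cellJump, hi]
  ring

lemma cellFunctional_add (hw : BoundedC 2 w M) (hw' : BoundedC 2 w' M') :
    cellFunctional x y nx ny i j (fun p => w p + w' p)
      = cellFunctional x y nx ny i j w + cellFunctional x y nx ny i j w' := by
  have h1 := cellJump_add (x := x) (y := y) (nx := nx) (i := i) (j := j) hw hw'
  have h2 := cellJump_add (x := y) (y := x) (nx := ny) (i := j) (j := i) hw.swap hw'.swap
  have h3 : ∫ s in y j..y (j + 1), ∫ t in x i..x (i + 1), (w (t, s) + w' (t, s))
      = (∫ s in y j..y (j + 1), ∫ t in x i..x (i + 1), w (t, s))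
        + ∫ s in y j..y (j + 1), ∫ t in x i..x (i + 1), w' (t, s) := by
    rw [← intervalIntegral.integral_add
      ((continuous_integral_x hw.continuous _ _).intervalIntegrable _ _)
      ((continuous_integral_x hw'.continuous _ _).intervalIntegrable _ _)]
    refine intervalIntegral.integral_congr fun s _ => ?_
    exact intervalIntegral.integral_add
      ((hw.continuous.comp (Continuous.prodMk_left s)).intervalIntegrable _ _)
      ((hw'.continuous.comp (Continuous.prodMk_left s)).intervalIntegrable _ _)
  simp only [cellFunctional, h1, h2, h3]
  ring

lemma abs_cellJump_le (hx : IsGrid x nx) (hy : IsGrid y ny) (hi : i < nx) (hj : j < ny)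
    (hw : BoundedC 3 w M) :
    |cellJump x y nx i j w| ≤ 3 * hmax x nx ^ 2 * M * (hMid x i * hMid y j) := by
  have hl : |y (j + 1) - y j| = hMid y j := abs_of_pos (hy.hMid_pos hj)
  have hh : |x (i + 1) - x i| = hMid x i := abs_of_pos (hx.hMid_pos hi)
  have hcont : ∀ a, Continuous fun s => pdx (pdx w) (a, s) := fun a =>
    hw.pdx.pdx.continuous.comp (Continuous.prodMk_right a)
  have hb : |∫ s in y j..y (j + 1), pdx (pdx w) (x (i + 1), s)| ≤ M * hMid y j := by
    rw [← hl]
    exact abs_integral_le_of_unit (hy.mem_unit hj.le) (hy.mem_unit hj)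
      fun t ht => hw.pdx.pdx.abs_le (hx.mem_unit hi) ht
  have hd : |(∫ s in y j..y (j + 1), pdx (pdx w) (x (i + 1), s))
      - ∫ s in y j..y (j + 1), pdx (pdx w) (x i, s)| ≤ M * hMid y j * hMid x i := by
    rw [← intervalIntegral.integral_sub ((hcont _).intervalIntegrable _ _)
      ((hcont _).intervalIntegrable _ _), ← hl, mul_right_comm]
    refine abs_integral_le_of_unit (hy.mem_unit hj.le) (hy.mem_unit hj) fun t ht => ?_
    rw [← hh]
    refine abs_sub_le_mul_of_deriv_on_uIcc (f := fun a => pdx (pdx w) (a, t))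
      (fun a _ => hw.pdx.pdx.hasDerivAt_x a t) fun a ha => ?_
    exact hw.pdx.pdx.pdx.abs_le
      (uIcc_subset_unit (hx.mem_unit hi.le) (hx.mem_unit hi) ha) ht
  calc _ ≤ _ := hx.abs_corrector_mul_sub_le hi
        (f := fun a => ∫ s in y j..y (j + 1), pdx (pdx w) (a, s)) hd hb
    _ = _ := by ring

lemma abs_integral_cell_sub_center_le (hx : IsGrid x nx) (hy : IsGrid y ny) (hi : i < nx)
    (hj : j < ny) (hw : BoundedC 2 w M) :
    |(∫ s in y j..y (j + 1), ∫ t in x i..x (i + 1), w (t, s))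
        - hMid x i * hMid y j * w (midpt x i, midpt y j)|
      ≤ (hmax x nx ^ 2 + hmax y ny ^ 2) * M * (hMid x i * hMid y j) := by
  have hl0 := hy.hMid_pos hj
  have hh0 := hx.hMid_pos hi
  have hl : |y (j + 1) - y j| = hMid y j := abs_of_pos hl0
  have hh : |x (i + 1) - x i| = hMid x i := abs_of_pos hh0
  have hc : Continuous fun s => w (midpt x i, s) :=
    hw.continuous.comp (Continuous.prodMk_right _)
  have h1 : |(∫ s in y j..y (j + 1), ((∫ t in x i..x (i + 1), w (t, s))
      - hMid x i * w (midpt x i, s)))| ≤ M * hMid x i ^ 3 * hMid y j := by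
    rw [← hl]
    refine abs_integral_le_of_unit (hy.mem_unit hj.le) (hy.mem_unit hj) fun s hs => ?_
    have h := integral_eq_midpoint (f := fun t => w (t, s))
      (hw.continuous.comp (Continuous.prodMk_left s))
      (hx.mem_unit hi.le) (hx.mem_unit hi) (fun t _ => hw.hasDerivAt_x t s)
      (fun t _ => hw.pdx.hasDerivAt_x t s) (fun t ht => hw.pdx.pdx.abs_le ht hs)
    rwa [hh] at h
  rw [intervalIntegral.integral_sub
    ((continuous_integral_x hw.continuous _ _).intervalIntegrable _ _)
    ((hc.const_mul _).intervalIntegrable _ _),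
    intervalIntegral.integral_const_mul] at h1
  have h2 := integral_eq_midpoint hc (hy.mem_unit hj.le) (hy.mem_unit hj)
      (fun t _ => hw.hasDerivAt_y _ t) (fun t _ => hw.pdy.hasDerivAt_y _ t)
      (fun t ht => hw.pdy.pdy.abs_le (hx.midpt_mem_unit hi) ht)
  rw [hl] at h2
  have h3 : M * hMid x i ^ 3 * hMid y j ≤ hmax x nx ^ 2 * M * (hMid x i * hMid y j) := by
    have := pow_le_pow_left₀ hh0.le (hMid_le_hmax hi) 2
    calc _ = hMid x i ^ 2 * (M * (hMid x i * hMid y j)) := by ring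
      _ ≤ hmax x nx ^ 2 * (M * (hMid x i * hMid y j)) :=
        mul_le_mul_of_nonneg_right this (mul_nonneg hw.nonneg (mul_pos hh0 hl0).le)
      _ = _ := by ring
  have h4 : hMid x i * (M * hMid y j ^ 3) ≤ hmax y ny ^ 2 * M * (hMid x i * hMid y j) := by
    have := pow_le_pow_left₀ hl0.le (hMid_le_hmax hj) 2
    calc _ = hMid y j ^ 2 * (M * (hMid x i * hMid y j)) := by ring
      _ ≤ hmax y ny ^ 2 * (M * (hMid x i * hMid y j)) :=
        mul_le_mul_of_nonneg_right this (mul_nonneg hw.nonneg (mul_pos hh0 hl0).le)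
      _ = _ := by ring
  have h5 : |hMid x i * ((∫ s in y j..y (j + 1), w (midpt x i, s))
      - hMid y j * w (midpt x i, midpt y j))| ≤ hMid x i * (M * hMid y j ^ 3) := by
    rw [abs_mul, abs_of_pos hh0]
    exact mul_le_mul_of_nonneg_left h2 hh0.le
  rw [abs_le] at *
  constructor <;> linarith [h1.1, h1.2, h5.1, h5.2]

/-- The cell functional is second-order close to the midpoint value. -/
lemma abs_cellFunctional_sub_center_le (hx : IsGrid x nx) (hy : IsGrid y ny) (hi : i < nx)
    (hj : j < ny) (hw : BoundedC 3 w M) :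
    |cellFunctional x y nx ny i j w / (hMid x i * hMid y j) - w (midpt x i, midpt y j)|
      ≤ 4 * (hmax x nx ^ 2 + hmax y ny ^ 2) * M := by
  have hp : 0 < hMid x i * hMid y j := mul_pos (hx.hMid_pos hi) (hy.hMid_pos hj)
  have h1 := abs_integral_cell_sub_center_le hx hy hi hj (hw.of_le (m := 2) (by norm_num))
  have h2 := abs_cellJump_le hx hy hi hj hw
  have h3 := abs_cellJump_le hy hx hj hi hw.swap
  rw [div_sub' hp.ne', abs_div, abs_of_pos hp, div_le_iff₀ hp, cellFunctional]
  rw [abs_le] at *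
  constructor <;> linarith [h1.1, h1.2, h2.1, h2.2, h3.1, h3.2]

end CellFunctional

section Lifting

variable {x y : ℕ → ℝ} {nx ny i j : ℕ} {F : ℝ × ℝ → ℝ} {M c : ℝ}

lemma pdx_eq_zero_of_eq_zero (h : ∀ t ∈ Set.Ioo (0 : ℝ) 1, F (t, c) = 0) :
    ∀ t ∈ Set.Ioo (0 : ℝ) 1, pdx F (t, c) = 0 := by
  intro t ht
  have : (fun s => F (s, c)) =ᶠ[nhds t] fun _ => 0 :=
    Filter.eventually_of_mem (Ioo_mem_nhds ht.1 ht.2) h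
  simp [pdx, this.deriv_eq]

lemma pdy_eq_zero_of_eq_zero (h : ∀ t ∈ Set.Ioo (0 : ℝ) 1, F (c, t) = 0) :
    ∀ t ∈ Set.Ioo (0 : ℝ) 1, pdy F (c, t) = 0 :=
  pdx_eq_zero_of_eq_zero (F := fun p => F p.swap) h

/-- The lifting of `F` to the points `(x_i, y_{j+1/2})`. -/
def lifting (x y : ℕ → ℝ) (nx ny : ℕ) (F : ℝ × ℝ → ℝ) (i j : ℕ) : ℝ :=
  edgeFlux y (corrector y ny)
    (fun s => F (x i, s) - corrector x nx i * pdx (pdx (pdx F)) (x i, s))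
    (fun s => pdy (pdy F) (x i, s)) j

/-- `F` vanishes on the boundary of the unit square. -/
def VanishesOnBoundary (F : ℝ × ℝ → ℝ) : Prop :=
  ∀ t ∈ Set.Icc (0 : ℝ) 1, F (0, t) = 0 ∧ F (1, t) = 0 ∧ F (t, 0) = 0 ∧ F (t, 1) = 0

lemma IsGrid.corrector_mul_eq_zero {g : ℝ → ℝ} (hx : IsGrid x nx) (hi : i ≤ nx)
    (hg : ∀ t ∈ Set.Ioo (0 : ℝ) 1, g t = 0) : corrector x nx i * g (x i) = 0 := by
  rcases eq_or_ne i 0 with rfl | h0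
  · rw [corrector_zero hx, zero_mul]
  rcases eq_or_ne i nx with rfl | hn
  · rw [corrector_last hx, zero_mul]
  · rw [hg _ (hx.mem_Ioo h0 (lt_of_le_of_ne hi hn)), mul_zero]

lemma IsGrid.corrector_mul_pdx_pdx_pdx_eq_zero (hx : IsGrid x nx) (hi : i ≤ nx)
    (h : ∀ t ∈ Set.Icc (0 : ℝ) 1, F (t, c) = 0) :
    corrector x nx i * pdx (pdx (pdx F)) (x i, c) = 0 :=
  hx.corrector_mul_eq_zero hi (g := fun t => pdx (pdx (pdx F)) (t, c))
    (pdx_eq_zero_of_eq_zero (pdx_eq_zero_of_eq_zero (pdx_eq_zero_of_eq_zero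
      fun t ht => h t (Set.Ioo_subset_Icc_self ht))))

lemma lifting_eq_zero (hy : IsGrid y ny) (hj : j < ny) (hi : corrector x nx i = 0)
    (h : ∀ t ∈ Set.Icc (0 : ℝ) 1, F (x i, t) = 0) : lifting x y nx ny F i j = 0 := by
  have hg : ∀ k ≤ ny, corrector y ny k * pdy (pdy F) (x i, y k) = 0 := fun k hk =>
    hy.corrector_mul_eq_zero hk (g := fun t => pdy (pdy F) (x i, t))
      (pdy_eq_zero_of_eq_zero (pdy_eq_zero_of_eq_zero
        fun t ht => h t (Set.Ioo_subset_Icc_self ht)))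
  have hint : (∫ s in y j..y (j + 1), F (x i, s)) = ∫ s in y j..y (j + 1), (0 : ℝ) :=
    intervalIntegral.integral_congr fun s hs =>
      h s (uIcc_subset_unit (hy.mem_unit hj.le) (hy.mem_unit hj) hs)
  simp [lifting, edgeFlux, hi, hg j hj.le, hg (j + 1) hj, hint]

lemma lifting_zero_left (hx : IsGrid x nx) (hy : IsGrid y ny) (hj : j < ny)
    (hF0 : VanishesOnBoundary F) : lifting x y nx ny F 0 j = 0 :=
  lifting_eq_zero hy hj (corrector_zero hx) fun t ht => by rw [hx.1]; exact (hF0 t ht).1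

lemma lifting_zero_right (hx : IsGrid x nx) (hy : IsGrid y ny) (hj : j < ny)
    (hF0 : VanishesOnBoundary F) : lifting x y nx ny F nx j = 0 :=
  lifting_eq_zero hy hj (corrector_last hx) fun t ht => by rw [hx.2.1]; exact (hF0 t ht).2.1

lemma IsGrid.abs_corrector_mul_le (hx : IsGrid x nx) (hi : i ≤ nx) {a : ℝ} (ha : |a| ≤ M) :
    |corrector x nx i * a| ≤ hmax x nx ^ 2 * M := by
  rw [abs_mul]
  exact mul_le_mul (hx.abs_corrector_le hi) ha (abs_nonneg _) (sq_nonneg _)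

/-- The lifting is second-order close to `F` at edge midpoints. -/
lemma abs_lifting_sub_le (hx : IsGrid x nx) (hy : IsGrid y ny) (hi : i ≤ nx) (hj : j < ny)
    (hF : ContDiff ℝ 3 F) (he : BoundedC 3 (pdx F) M) (hg : BoundedC 2 (pdy (pdy F)) M) :
    |lifting x y nx ny F i j - F (x i, midpt y j)|
      ≤ 4 * (hmax x nx ^ 2 + hmax y ny ^ 2) * M := by
  have hxi := hx.mem_unit hi
  have h1 : ContDiff ℝ 1 F := hF.of_le (by norm_num)
  have h2 : ContDiff ℝ 1 (pdy F) := (ContDiff.pdy (n := 2) hF).of_le (by norm_num)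
  have h := edgeFlux_sub_midpt (f := fun s => F (x i, s))
    (k := fun s => corrector x nx i * pdx (pdx (pdx F)) (x i, s)) hy hj
    (hF.continuous.comp (Continuous.prodMk_right _))
    ((he.pdx.pdx.continuous.comp (Continuous.prodMk_right _)).const_mul _)
    (fun t _ => hasDerivAt_pdy h1 _ t) (fun t _ => hasDerivAt_pdy h2 _ t)
    (fun t _ => hg.hasDerivAt_y _ t) (fun t ht => hg.abs_le hxi ht)
    (fun t ht => hg.pdy.abs_le hxi ht)
    (fun t ht => hx.abs_corrector_mul_le hi (he.pdx.pdx.abs_le hxi ht))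
  refine h.trans ?_
  have := mul_nonneg (sq_nonneg (hmax x nx)) hg.nonneg
  linarith

/-- The tangential difference quotient of the lifting is second-order close to `∂_y F` at the
grid nodes, including the boundary ones. -/
lemma abs_DyE_lifting_sub_le (hx : IsGrid x nx) (hy : IsGrid y ny) (hi : i ≤ nx) (hj : j ≤ ny)
    (hF : ContDiff ℝ 3 F) (he : BoundedC 3 (pdx F) M) (hg : BoundedC 2 (pdy (pdy F)) M)
    (hF0 : VanishesOnBoundary F) :
    |DyE y ny (lifting x y nx ny F) (fun _ => 0) (fun _ => 0) i j - pdy F (x i, y j)|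
      ≤ 6 * (hmax x nx ^ 2 + hmax y ny ^ 2) * M := by
  have hxi := hx.mem_unit hi
  have h1 : ContDiff ℝ 1 F := hF.of_le (by norm_num)
  have h2 : ContDiff ℝ 1 (pdy F) := (ContDiff.pdy (n := 2) hF).of_le (by norm_num)
  have h := DyE_edgeFlux (f := fun s => F (x i, s))
    (k := fun s => corrector x nx i * pdx (pdx (pdx F)) (x i, s)) hy
    (hF.continuous.comp (Continuous.prodMk_right _))
    ((he.pdx.pdx.continuous.comp (Continuous.prodMk_right _)).const_mul _)
    (fun t _ => hasDerivAt_pdy h1 _ t) (fun t _ => hasDerivAt_pdy h2 _ t)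
    (fun t _ => hg.hasDerivAt_y _ t) (fun t _ => hg.pdy.hasDerivAt_y _ t)
    (fun t _ => (he.pdx.pdx.hasDerivAt_y _ t).const_mul _)
    (fun t ht => hg.abs_le hxi ht)
    (fun t ht => hg.pdy.abs_le hxi ht) (fun t ht => hg.pdy.pdy.abs_le hxi ht)
    (fun t ht => hx.abs_corrector_mul_le hi (he.pdx.pdx.pdy.abs_le hxi ht))
    (hF0 _ hxi).2.2.1 (hF0 _ hxi).2.2.2
    (hx.corrector_mul_pdx_pdx_pdx_eq_zero hi fun t ht => (hF0 t ht).2.2.1)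
    (hx.corrector_mul_pdx_pdx_pdx_eq_zero hi fun t ht => (hF0 t ht).2.2.2)
    hj (v := lifting x y nx ny F) (fun _ => rfl)
  refine h.trans ?_
  have := mul_nonneg (sq_nonneg (hmax x nx)) hg.nonneg
  linarith

/-- The normal difference quotient of the lifting is the cell functional of `∂_x F`. -/
lemma lifting_succ_sub (hy : IsGrid y ny) (hj : j < ny)
    (hF : ContDiff ℝ 3 F) (he : BoundedC 3 (pdx F) M) (hg : BoundedC 2 (pdy (pdy F)) M) :
    lifting x y nx ny F (i + 1) j - lifting x y nx ny F i j
      = cellFunctional x y nx ny i j (pdx F) / hMid y j := by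
  have hcF : ∀ a, Continuous fun s => F (a, s) := fun a =>
    hF.continuous.comp (Continuous.prodMk_right a)
  have hck : ∀ a, Continuous fun s => pdx (pdx (pdx F)) (a, s) := fun a =>
    he.pdx.pdx.continuous.comp (Continuous.prodMk_right a)
  have hsplit : ∀ a c, ∫ s in y j..y (j + 1), (F (a, s) - c * pdx (pdx (pdx F)) (a, s))
      = (∫ s in y j..y (j + 1), F (a, s))
        - c * ∫ s in y j..y (j + 1), pdx (pdx (pdx F)) (a, s) := fun a c => by
    rw [intervalIntegral.integral_sub ((hcF a).intervalIntegrable _ _)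
      (((hck a).const_mul c).intervalIntegrable _ _), intervalIntegral.integral_const_mul]
  have hmain : (∫ s in y j..y (j + 1), F (x (i + 1), s)) - ∫ s in y j..y (j + 1), F (x i, s)
      = ∫ s in y j..y (j + 1), ∫ t in x i..x (i + 1), pdx F (t, s) := by
    rw [← intervalIntegral.integral_sub ((hcF _).intervalIntegrable _ _)
      ((hcF _).intervalIntegrable _ _)]
    refine intervalIntegral.integral_congr fun s _ => ?_
    exact (intervalIntegral.integral_eq_sub_of_hasDerivAt
      (fun t _ => hasDerivAt_pdx (hF.of_le (by norm_num)) t s)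
      ((he.continuous.comp (Continuous.prodMk_left s)).intervalIntegrable _ _)).symm
  have hcomm : pdx (pdy (pdy F)) = pdy (pdy (pdx F)) := by
    rw [pdx_pdy_comm (ContDiff.pdy (n := 2) hF), pdx_pdy_comm (hF.of_le (by norm_num))]
  have hjump : ∀ b, pdy (pdy F) (x (i + 1), b) - pdy (pdy F) (x i, b)
      = ∫ t in x i..x (i + 1), pdy (pdy (pdx F)) (t, b) := fun b => by
    refine (intervalIntegral.integral_eq_sub_of_hasDerivAt (f := fun t => pdy (pdy F) (t, b))
      (fun t _ => ?_)
      ((he.pdy.pdy.continuous.comp (Continuous.prodMk_left b)).intervalIntegrable _ _)).symm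
    have := hg.hasDerivAt_x t b
    rwa [hcomm] at this
  have e : cellJump y x ny j i (fun p => pdx F p.swap)
      = corrector y ny (j + 1) * (pdy (pdy F) (x (i + 1), y (j + 1))
          - pdy (pdy F) (x i, y (j + 1)))
        - corrector y ny j * (pdy (pdy F) (x (i + 1), y j) - pdy (pdy F) (x i, y j)) := by
    rw [hjump, hjump]; rfl
  simp only [lifting, edgeFlux, hsplit, cellFunctional, e, ← hmain]
  rw [cellJump]
  have := (hy.hMid_pos hj).ne'
  field_simp
  ring

end Lifting

/-! ### Error estimates -/

section Assembly

variable {x y : ℕ → ℝ} {nx ny i j : ℕ} {lam mu N : ℝ} {ux uy s11 s22 s12 : ℝ × ℝ → ℝ}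

/-- The corrected midpoint value of a normal stress. -/
def normalStress (x y : ℕ → ℝ) (s : ℝ × ℝ → ℝ) (i j : ℕ) : ℝ :=
  s (midpt x i, midpt y j) - hMid x i ^ 2 / 8 * pdx (pdx s) (midpt x i, midpt y j)

lemma abs_momentum_residual_le (hx : IsGrid x nx) (hy : IsGrid y ny) (h0 : i ≠ 0) (hi : i < nx)
    (hj : j < ny) {s t : ℝ × ℝ → ℝ} (hs : BoundedC 3 s N) (ht : BoundedC 3 t N) :
    |(normalStress x y s i j - normalStress x y s (i - 1) j) / hNode x nx i
        + (t (x i, y (j + 1)) - t (x i, y j)) / hMid y j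
        - (pdx s (x i, midpt y j) + pdy t (x i, midpt y j))|
      ≤ 2 * (hmax x nx ^ 2 + hmax y ny ^ 2) * N := by
  have hm := hy.midpt_mem_unit hj
  have hxi := hx.mem_unit hi.le
  have hl := hy.hMid_pos hj
  have h1 := corrected_midpt_quotient (f := fun a => s (a, midpt y j)) hx h0 hi
    (fun a _ => hs.hasDerivAt_x a _) (fun a _ => hs.pdx.hasDerivAt_x a _)
    (fun a _ => hs.pdx.pdx.hasDerivAt_x a _) (fun a ha => hs.pdx.pdx.pdx.abs_le ha hm)
  have h2 := sub_eq_midpoint_deriv (f := fun b => t (x i, b)) (hy.mem_unit hj.le)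
    (hy.mem_unit (j := j + 1) hj)
    (fun b _ => ht.hasDerivAt_y _ b) (fun b _ => ht.pdy.hasDerivAt_y _ b)
    (fun b _ => ht.pdy.pdy.hasDerivAt_y _ b) (fun b hb => ht.pdy.pdy.pdy.abs_le hxi hb)
  have h3 : |(t (x i, y (j + 1)) - t (x i, y j)) / hMid y j - pdy t (x i, midpt y j)|
      ≤ hmax y ny ^ 2 * N := by
    rw [div_sub' hl.ne', abs_div, abs_of_pos hl, div_le_iff₀ hl]
    refine h2.trans ?_
    change N * |hMid y j| ^ 3 ≤ _
    rw [abs_of_pos hl]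
    have := pow_le_pow_left₀ hl.le (hMid_le_hmax hj) 2
    calc _ = hMid y j ^ 2 * (N * hMid y j) := by ring
      _ ≤ hmax y ny ^ 2 * (N * hMid y j) :=
        mul_le_mul_of_nonneg_right this (mul_nonneg hs.nonneg hl.le)
      _ = _ := by ring
  have h4 := mul_nonneg (sq_nonneg (hmax y ny)) hs.nonneg
  simp only [normalStress]
  rw [abs_le] at *
  constructor <;> linarith [h1.1, h1.2, h3.1, h3.2]

lemma DyE_sub {v w : ℕ → ℕ → ℝ} {v0 vn : ℕ → ℝ} (h0 : v0 i = 0) (hn : vn i = 0) :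
    DyE y ny (fun i j => v i j - w i j) (fun _ => 0) (fun _ => 0) i j
      = DyE y ny v v0 vn i j - DyE y ny w (fun _ => 0) (fun _ => 0) i j := by
  simp only [DyE, h0, hn]
  split_ifs <;> ring

/-- The exact solution in terms of a common bound `N` for the stress, uniformly in `lam`. -/
structure ElasticData (lam mu N : ℝ) (ux uy s11 s22 s12 : ℝ × ℝ → ℝ) : Prop where
  mu_pos : 0 < mu
  lam_pos : 0 < lam
  contDiff_ux : ContDiff ℝ 3 ux
  contDiff_uy : ContDiff ℝ 3 uy
  ux_boundary : VanishesOnBoundary ux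
  uy_boundary : VanishesOnBoundary uy
  s11_eq : ∀ p, s11 p = (lam + 2 * mu) * pdx ux p + lam * pdy uy p
  s22_eq : ∀ p, s22 p = lam * pdx ux p + (lam + 2 * mu) * pdy uy p
  s12_eq : ∀ p, s12 p = mu * (pdy ux p + pdx uy p)
  s11_bound : BoundedC 3 s11 N
  s22_bound : BoundedC 3 s22 N
  s12_bound : BoundedC 3 s12 N

namespace ElasticData

/-- Exchanging the roles of the two coordinates. -/
lemma swap (h : ElasticData lam mu N ux uy s11 s22 s12) :
    ElasticData lam mu N (fun p => uy p.swap) (fun p => ux p.swap) (fun p => s22 p.swap)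
      (fun p => s11 p.swap) (fun p => s12 p.swap) where
  mu_pos := h.mu_pos
  lam_pos := h.lam_pos
  contDiff_ux := h.contDiff_uy.comp (contDiff_snd.prodMk contDiff_fst)
  contDiff_uy := h.contDiff_ux.comp (contDiff_snd.prodMk contDiff_fst)
  ux_boundary := fun t ht =>
    ⟨(h.uy_boundary t ht).2.2.1, (h.uy_boundary t ht).2.2.2, (h.uy_boundary t ht).1,
      (h.uy_boundary t ht).2.1⟩
  uy_boundary := fun t ht =>
    ⟨(h.ux_boundary t ht).2.2.1, (h.ux_boundary t ht).2.2.2, (h.ux_boundary t ht).1,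
      (h.ux_boundary t ht).2.1⟩
  s11_eq := fun p => (h.s22_eq p.swap).trans (add_comm _ _)
  s22_eq := fun p => (h.s11_eq p.swap).trans (add_comm _ _)
  s12_eq := fun p => (h.s12_eq p.swap).trans (congrArg _ (add_comm _ _))
  s11_bound := h.s22_bound.swap
  s22_bound := h.s11_bound.swap
  s12_bound := h.s12_bound.swap

variable (h : ElasticData lam mu N ux uy s11 s22 s12)
include h

lemma div_eq (p : ℝ × ℝ) :
    pdx ux p + pdy uy p = 1 / (2 * (lam + mu)) * (s11 p + s22 p) := by
  have := h.mu_pos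
  have := h.lam_pos
  rw [h.s11_eq, h.s22_eq]
  field_simp
  ring

lemma diff_eq (p : ℝ × ℝ) : pdx ux p - pdy uy p = (s11 p - s22 p) / (2 * mu) := by
  have := h.mu_pos
  rw [h.s11_eq, h.s22_eq]
  field_simp
  ring

lemma div_bound :
    BoundedC 3 (fun p => pdx ux p + pdy uy p) (1 / (2 * (lam + mu)) * (2 * N)) := by
  have h1 := h.mu_pos
  have h2 := h.lam_pos
  have := (h.s11_bound.add h.s22_bound).const_mul (1 / (2 * (lam + mu)))
  rw [abs_of_pos (by positivity)] at this
  rw [funext h.div_eq, two_mul N]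
  exact this

lemma nu_le : 1 / (2 * (lam + mu)) ≤ 1 / (2 * mu) :=
  one_div_le_one_div_of_le (by linarith [h.mu_pos]) (by linarith [h.lam_pos])

lemma strain_bound : BoundedC 3 (pdx ux) (N / mu) := by
  have h1 := h.mu_pos
  have h2 := h.lam_pos
  have hN := h.s11_bound.nonneg
  have e : pdx ux = fun p => 1 / 2 * (pdx ux p + pdy uy p)
      + (1 / (4 * mu) * s11 p + -(1 / (4 * mu)) * s22 p) := by
    funext p
    have := h.diff_eq p
    have e2 : 1 / (4 * mu) * s11 p + -(1 / (4 * mu)) * s22 p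
      = 1 / 2 * ((s11 p - s22 p) / (2 * mu)) := by field_simp; ring
    rw [e2, ← this]
    ring
  rw [e]
  refine ((h.div_bound.const_mul _).add
    ((h.s11_bound.const_mul _).add (h.s22_bound.const_mul _))).mono ?_
  rw [abs_neg, abs_of_pos (by positivity : 0 < 1 / (4 * mu)),
    abs_of_pos (by norm_num : (0 : ℝ) < 1 / 2)]
  have h3 : 1 / (2 * (lam + mu)) * N ≤ 1 / (2 * mu) * N :=
    mul_le_mul_of_nonneg_right h.nu_le hN
  calc _ = 1 / (2 * (lam + mu)) * N + 1 / (2 * mu) * N := by field_simp; ring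
    _ ≤ 1 / (2 * mu) * N + 1 / (2 * mu) * N := by gcongr
    _ = N / mu := by field_simp; ring

lemma pdy_pdy_bound : BoundedC 2 (pdy (pdy ux)) (2 * N / mu) := by
  have h1 := h.mu_pos
  have he := h.swap.strain_bound.swap
  change BoundedC 3 (pdy uy) (N / mu) at he
  have e : pdy (pdy ux) = fun p => 1 / mu * pdy s12 p + -1 * pdx (pdy uy) p := by
    funext ⟨a, b⟩
    have d1 := h.s12_bound.hasDerivAt_y a b
    have d2 := (hasDerivAt_pdy ((ContDiff.pdx (n := 2) h.contDiff_uy).of_le (by norm_num)) a b)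
    have d3 := ((d1.const_mul (1 / mu)).sub d2).deriv
    rw [pdx_pdy_comm (h.contDiff_uy.of_le (by norm_num)), neg_one_mul, ← sub_eq_add_neg, ← d3]
    refine congrArg (fun f => deriv f b) (funext fun t => ?_)
    simp only [Pi.sub_apply, h.s12_eq]
    field_simp
    ring
  rw [e]
  refine ((h.s12_bound.pdy.const_mul _).add (he.pdx.const_mul _)).mono (le_of_eq ?_)
  rw [abs_of_pos (by positivity : 0 < 1 / mu), abs_neg, abs_one]
  ring

lemma abs_lifting_sub_le (hx : IsGrid x nx) (hy : IsGrid y ny) (hi : i ≤ nx) (hj : j < ny) :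
    |lifting x y nx ny ux i j - (ux (x i, midpt y j)
        - hMid y j ^ 2 / 8 * pdy (pdy ux) (x i, midpt y j))|
      ≤ 9 / mu * (hmax x nx ^ 2 + hmax y ny ^ 2) * N := by
  have hmu := h.mu_pos
  have hN := h.s11_bound.nonneg
  have h0 : N / mu ≤ 2 * N / mu := by gcongr; linarith
  have h1 := _root_.abs_lifting_sub_le hx hy hi hj h.contDiff_ux (h.strain_bound.mono h0)
    h.pdy_pdy_bound
  have h2 : |hMid y j ^ 2 / 8 * pdy (pdy ux) (x i, midpt y j)|
      ≤ hmax y ny ^ 2 / 8 * (2 * N / mu) := by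
    rw [abs_mul, abs_of_nonneg (by positivity)]
    have := pow_le_pow_left₀ (hy.hMid_pos hj).le (hMid_le_hmax hj) 2
    exact mul_le_mul (by linarith)
      (h.pdy_pdy_bound.abs_le (hx.mem_unit hi) (hy.midpt_mem_unit hj)) (abs_nonneg _)
      (by positivity)
  have h3 : 0 ≤ hmax x nx ^ 2 * (N / mu) := by positivity
  have h4 : 0 ≤ hmax y ny ^ 2 * (N / mu) := by positivity
  rw [mul_div_assoc] at h1 h2
  have e : 9 / mu * (hmax x nx ^ 2 + hmax y ny ^ 2) * N
      = 9 * (hmax x nx ^ 2 * (N / mu)) + 9 * (hmax y ny ^ 2 * (N / mu)) := by ring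
  rw [abs_le] at *
  constructor <;> linarith [h1.1, h1.2, h2.1, h2.2]

lemma abs_DyE_lifting_sub_le (hx : IsGrid x nx) (hy : IsGrid y ny) (hi : i ≤ nx) (hj : j ≤ ny) :
    |DyE y ny (lifting x y nx ny ux) (fun _ => 0) (fun _ => 0) i j - pdy ux (x i, y j)|
      ≤ 12 / mu * (hmax x nx ^ 2 + hmax y ny ^ 2) * N := by
  have hmu := h.mu_pos
  have hN := h.s11_bound.nonneg
  have h0 : N / mu ≤ 2 * N / mu := by gcongr; linarith
  refine (_root_.abs_DyE_lifting_sub_le hx hy hi hj h.contDiff_ux (h.strain_bound.mono h0)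
    h.pdy_pdy_bound h.ux_boundary).trans (le_of_eq ?_)
  ring

lemma lifting_quotient (hx : IsGrid x nx) (hy : IsGrid y ny) (hi : i < nx) (hj : j < ny) :
    (lifting x y nx ny ux (i + 1) j - lifting x y nx ny ux i j) / hMid x i
      = cellFunctional x y nx ny i j (pdx ux) / (hMid x i * hMid y j) := by
  have hmu := h.mu_pos
  have hN := h.s11_bound.nonneg
  have h0 : N / mu ≤ 2 * N / mu := by gcongr; linarith
  rw [lifting_succ_sub hy hj h.contDiff_ux (h.strain_bound.mono h0) h.pdy_pdy_bound]
  have := (hx.hMid_pos hi).ne'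
  have := (hy.hMid_pos hj).ne'
  field_simp

lemma lifting_quotient_swap (hx : IsGrid x nx) (hy : IsGrid y ny) (hi : i < nx) (hj : j < ny) :
    (lifting y x ny nx (fun p => uy p.swap) (j + 1) i
        - lifting y x ny nx (fun p => uy p.swap) j i) / hMid y j
      = cellFunctional x y nx ny i j (pdy uy) / (hMid x i * hMid y j) := by
  rw [h.swap.lifting_quotient hy hx hj hi, mul_comm (hMid y j)]
  have he : Continuous (pdy uy) := h.swap.strain_bound.swap.continuous
  rw [← cellFunctional_swap he]
  rfl

lemma abs_normalStress_sub_le (hx : IsGrid x nx) (hy : IsGrid y ny) (hi : i < nx) (hj : j < ny) :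
    |normalStress x y s11 i j - s11 (midpt x i, midpt y j)| ≤ hmax x nx ^ 2 / 8 * N := by
  rw [normalStress, sub_sub_cancel_left, abs_neg, abs_mul, abs_of_nonneg (by positivity)]
  have := pow_le_pow_left₀ (hx.hMid_pos hi).le (hMid_le_hmax hi) 2
  exact mul_le_mul (by linarith)
      (h.s11_bound.pdx.pdx.abs_le (hx.midpt_mem_unit hi) (hy.midpt_mem_unit hj)) (abs_nonneg _)
      (by positivity)

/-- Consistency of the discrete divergence, with a bound uniform in `lam`. -/
lemma abs_div_residual_le (hx : IsGrid x nx) (hy : IsGrid y ny) (hi : i < nx) (hj : j < ny) :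
    |1 / (2 * (lam + mu)) * (normalStress x y s11 i j
        + normalStress y x (fun p => s22 p.swap) j i)
      - ((lifting x y nx ny ux (i + 1) j - lifting x y nx ny ux i j) / hMid x i
        + (lifting y x ny nx (fun p => uy p.swap) (j + 1) i
            - lifting y x ny nx (fun p => uy p.swap) j i) / hMid y j)|
      ≤ 1 / (2 * (lam + mu)) * (9 * (hmax x nx ^ 2 + hmax y ny ^ 2) * N) := by
  have hmu := h.mu_pos
  have hlam := h.lam_pos
  have hN := h.s11_bound.nonneg
  have he2 : BoundedC 3 (pdy uy) (N / mu) := h.swap.strain_bound.swap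
  rw [h.lifting_quotient hx hy hi hj, h.lifting_quotient_swap hx hy hi hj, ← add_div,
    ← cellFunctional_add (h.strain_bound.of_le (by norm_num)) (he2.of_le (by norm_num))]
  have h1 := abs_cellFunctional_sub_center_le hx hy hi hj h.div_bound
  simp only [h.div_eq (midpt x i, midpt y j)] at h1
  have h2 := h.abs_normalStress_sub_le hx hy hi hj
  have h3 := h.swap.abs_normalStress_sub_le hy hx hj hi
  simp only [Prod.swap_prod_mk] at h3
  set nu := 1 / (2 * (lam + mu))
  have hnu : 0 < nu := by positivity
  have h4 := mul_le_mul_of_nonneg_left (add_le_add h2 h3) hnu.le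
  have h5 := (mul_le_mul_of_nonneg_left (abs_add_le (normalStress x y s11 i j
      - s11 (midpt x i, midpt y j)) (normalStress y x (fun p => s22 p.swap) j i
      - s22 (midpt x i, midpt y j))) hnu.le).trans h4
  rw [← abs_of_pos hnu, ← abs_mul, abs_of_pos hnu] at h5
  have h6 : 0 ≤ nu * (hmax x nx ^ 2 * N) := by positivity
  have h7 : 0 ≤ nu * (hmax y ny ^ 2 * N) := by positivity
  rw [abs_le] at *
  constructor <;> linarith [h1.1, h1.2, h5.1, h5.2]

/-- Consistency of the difference of the normal strains. -/
lemma abs_diff_residual_le (hx : IsGrid x nx) (hy : IsGrid y ny) (hi : i < nx) (hj : j < ny) :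
    |(normalStress x y s11 i j - normalStress y x (fun p => s22 p.swap) j i) / (2 * mu)
      - ((lifting x y nx ny ux (i + 1) j - lifting x y nx ny ux i j) / hMid x i
        - (lifting y x ny nx (fun p => uy p.swap) (j + 1) i
            - lifting y x ny nx (fun p => uy p.swap) j i) / hMid y j)|
      ≤ 9 / mu * (hmax x nx ^ 2 + hmax y ny ^ 2) * N := by
  have hmu := h.mu_pos
  have hN := h.s11_bound.nonneg
  have he2 : BoundedC 3 (pdy uy) (N / mu) := h.swap.strain_bound.swap
  rw [h.lifting_quotient hx hy hi hj, h.lifting_quotient_swap hx hy hi hj]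
  have h0 := h.diff_eq (midpt x i, midpt y j)
  have h1 := abs_cellFunctional_sub_center_le hx hy hi hj h.strain_bound
  have h1' := abs_cellFunctional_sub_center_le hx hy hi hj he2
  have h2 := h.abs_normalStress_sub_le hx hy hi hj
  have h3 := h.swap.abs_normalStress_sub_le hy hx hj hi
  simp only [Prod.swap_prod_mk] at h3
  have h5 : |(normalStress x y s11 i j - normalStress y x (fun p => s22 p.swap) j i) / (2 * mu)
      - (s11 (midpt x i, midpt y j) - s22 (midpt x i, midpt y j)) / (2 * mu)|
      ≤ (hmax x nx ^ 2 + hmax y ny ^ 2) * (N / mu) := by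
    rw [← sub_div, abs_div, abs_of_pos (by positivity : 0 < 2 * mu),
      div_le_iff₀ (by positivity),
      show (hmax x nx ^ 2 + hmax y ny ^ 2) * (N / mu) * (2 * mu)
        = 2 * (hmax x nx ^ 2 * N + hmax y ny ^ 2 * N) by field_simp]
    have h6 : 0 ≤ hmax x nx ^ 2 * N := by positivity
    have h7 : 0 ≤ hmax y ny ^ 2 * N := by positivity
    rw [abs_le] at *
    constructor <;> linarith [h2.1, h2.2, h3.1, h3.2]
  rw [show 9 / mu * (hmax x nx ^ 2 + hmax y ny ^ 2) * N
    = 9 * ((hmax x nx ^ 2 + hmax y ny ^ 2) * (N / mu)) by ring]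
  rw [← h0] at h5
  rw [abs_le] at *
  constructor <;> linarith [h1.1, h1.2, h1'.1, h1'.2, h5.1, h5.2]

end ElasticData

end Assembly

section ErrorEstimate

variable {x y : ℕ → ℝ} {nx ny : ℕ} {lam mu N : ℝ} {ux uy s11 s22 s12 : ℝ × ℝ → ℝ}
  {Wx Wy Z11 Z22 Z12 : ℕ → ℕ → ℝ} {Wx0 Wxn Wy0 Wyn : ℕ → ℝ}

/-- The discrete solution is second-order close to the lifting of the exact one. -/
lemma ElasticData.discrete_error_le (h : ElasticData lam mu N ux uy s11 s22 s12)
    (hx : IsGrid x nx) (hy : IsGrid y ny)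
    (hsol : MACESol nx ny x y lam mu Wx Wx0 Wxn Wy Wy0 Wyn Z11 Z22 Z12
      (fun i j => pdx s11 (x i, midpt y j) + pdy s12 (x i, midpt y j))
      (fun i j => pdx s12 (midpt x i, y j) + pdy s22 (midpt x i, y j)))
    {K : ℝ} (hK : K = (24 / mu + 9) * (hmax x nx ^ 2 + hmax y ny ^ 2) * N) :
    ∑ i ∈ Ico 1 nx, ∑ j ∈ range ny, hNode x nx i * hMid y j *
          (Wx i j - lifting x y nx ny ux i j) ^ 2 ≤ (40 / mu ^ 2 + 16) * K ^ 2 ∧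
      ∑ i ∈ range nx, ∑ j ∈ Ico 1 ny, hMid x i * hNode y ny j *
          (Wy i j - lifting y x ny nx (fun p => uy p.swap) j i) ^ 2
        ≤ (40 / mu ^ 2 + 16) * K ^ 2 ∧
      ∑ i ∈ range (nx + 1), ∑ j ∈ range (ny + 1), hNode x nx i * hNode y ny j *
          (Z12 i j - s12 (x i, y j)) ^ 2 ≤ (10 + 4 * mu ^ 2) * K ^ 2 := by
  obtain ⟨hWx, hWx0, hWy, hWy0, hc1, hc2, hsh, hm1, hm2⟩ := hsol
  beta_reduce at hm1 hm2
  have hmu := h.mu_pos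
  have hlam := h.lam_pos
  have hN := h.s11_bound.nonneg
  set H := hmax x nx ^ 2 + hmax y ny ^ 2 with hH
  have hHN : 0 ≤ H * N := by positivity
  have hHNm : 0 ≤ H * N / mu := by positivity
  have hK' : K = 24 * (H * N / mu) + 9 * (H * N) := by rw [hK]; ring
  have hnu : 0 < 1 / (2 * (lam + mu)) := by positivity
  have hnm : 1 / (2 * (lam + mu)) * (2 * mu) ≤ 1 := by
    rw [one_div_mul_eq_div, div_le_one (by positivity)]; linarith
  refine discrete_energy_estimate hmu hnu hnm hx hy
    (fun i j => Wx i j - lifting x y nx ny ux i j)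
    (fun i j => Wy i j - lifting y x ny nx (fun p => uy p.swap) j i)
    (fun i j => Z11 i j - normalStress x y s11 i j)
    (fun i j => Z22 i j - normalStress y x (fun p => s22 p.swap) j i)
    (fun i j => Z12 i j - s12 (x i, y j)) ?_ ?_ ?_ ?_ ?_ ?_ ?_
  · intro j hj
    simp only [hWx j hj, lifting_zero_left hx hy hj h.ux_boundary,
      lifting_zero_right hx hy hj h.ux_boundary, sub_zero, and_self]
  · intro i hi
    simp only [hWy i hi, lifting_zero_left hy hx hi h.swap.ux_boundary,
      lifting_zero_right hy hx hi h.swap.ux_boundary, sub_zero, and_self]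
  · intro i h0 hi j hj
    have h1 := abs_momentum_residual_le hx hy h0 hi hj h.s11_bound h.s12_bound
    rw [← hm1 i (Nat.one_le_iff_ne_zero.2 h0) hi j hj, ← hH] at h1
    rw [abs_sub_comm] at h1
    have e : (Z11 i j - normalStress x y s11 i j
          - (Z11 (i - 1) j - normalStress x y s11 (i - 1) j)) / hNode x nx i
        + (Z12 i (j + 1) - s12 (x i, y (j + 1)) - (Z12 i j - s12 (x i, y j))) / hMid y j
        = (Z11 i j - Z11 (i - 1) j) / hNode x nx i + (Z12 i (j + 1) - Z12 i j) / hMid y j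
          - ((normalStress x y s11 i j - normalStress x y s11 (i - 1) j) / hNode x nx i
            + (s12 (x i, y (j + 1)) - s12 (x i, y j)) / hMid y j) := by ring
    rw [e]
    linarith
  · intro i hi j h0 hj
    have h1 := abs_momentum_residual_le hy hx h0 hj hi h.swap.s11_bound h.swap.s12_bound
    change |_ - (pdy s22 (midpt x i, y j) + pdx s12 (midpt x i, y j))| ≤ _ at h1
    simp only [Prod.swap_prod_mk] at h1
    rw [add_comm (pdy s22 _), ← hm2 i hi j (Nat.one_le_iff_ne_zero.2 h0) hj,
      add_comm (hmax y ny ^ 2), ← hH] at h1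
    rw [abs_sub_comm] at h1
    refine le_trans (le_of_eq (congrArg abs ?_)) (h1.trans (by linarith))
    ring
  · intro i hi j hj
    have h1 := h.abs_div_residual_le hx hy hi hj
    have e0 : (Wx (i + 1) j - Wx i j) / hMid x i + (Wy i (j + 1) - Wy i j) / hMid y j
        = 1 / (2 * (lam + mu)) * (Z11 i j + Z22 i j) := by
      rw [← hc1 i hi j hj, ← hc2 i hi j hj]
      field_simp
      ring
    refine le_trans (le_of_eq (congrArg abs ?_)) (h1.trans
      (mul_le_mul_of_nonneg_left (by linarith) hnu.le))
    linear_combination e0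
  · intro i hi j hj
    have h1 := h.abs_diff_residual_le hx hy hi hj
    have e1 : 9 / mu * H * N = 9 * (H * N / mu) := by ring
    rw [← hH, e1] at h1
    have e0 : (Wx (i + 1) j - Wx i j) / hMid x i - (Wy i (j + 1) - Wy i j) / hMid y j
        = (Z11 i j - Z22 i j) / (2 * mu) := by
      rw [← hc1 i hi j hj, ← hc2 i hi j hj]
      field_simp
      ring
    refine le_trans (le_of_eq (congrArg abs ?_)) (h1.trans (by linarith))
    linear_combination e0
  · intro i hi j hj
    have h1 := h.abs_DyE_lifting_sub_le hx hy hi hj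
    have h2 := h.swap.abs_DyE_lifting_sub_le hy hx hj hi
    change |_ - pdx uy (x i, y j)| ≤ _ at h2
    rw [DyE_sub (hWx0 i hi).1 (hWx0 i hi).2]
    change |_ - (_ + DyE x nx (fun j i => Wy i j
      - lifting y x ny nx (fun p => uy p.swap) j i) (fun _ => 0) (fun _ => 0) j i)| ≤ K
    rw [DyE_sub (v := fun j i => Wy i j) (hWy0 j hj).1 (hWy0 j hj).2]
    have e : (Z12 i j - s12 (x i, y j)) / mu = DyE y ny Wx Wx0 Wxn i j
        + DyE x nx (fun j i => Wy i j) Wy0 Wyn j i - (pdy ux (x i, y j) + pdx uy (x i, y j)) := by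
      rw [hsh i hi j hj, h.s12_eq, ← mul_sub, mul_div_cancel_left₀ _ hmu.ne']
      rfl
    rw [e]
    rw [add_comm (hmax y ny ^ 2)] at h2
    have e1 : 12 / mu * H * N = 12 * (H * N / mu) := by ring
    rw [← hH, e1] at h1 h2
    rw [abs_le] at *
    constructor <;> linarith [h1.1, h1.2, h2.1, h2.2]

lemma sqrt_weighted_sum_le {s t : Finset ℕ} {a b : ℕ → ℝ} {e p : ℕ → ℕ → ℝ} {A K : ℝ}
    (hK : 0 ≤ K) (ha : ∀ i ∈ s, 0 ≤ a i) (hb : ∀ j ∈ t, 0 ≤ b j)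
    (ha1 : ∑ i ∈ s, a i ≤ 1) (hb1 : ∑ j ∈ t, b j ≤ 1)
    (he : ∑ i ∈ s, ∑ j ∈ t, a i * b j * e i j ^ 2 ≤ A * K ^ 2)
    (hp : ∀ i ∈ s, ∀ j ∈ t, |p i j - e i j| ≤ K) :
    Real.sqrt (∑ i ∈ s, ∑ j ∈ t, a i * b j * p i j * p i j) ≤ Real.sqrt (2 * A + 2) * K := by
  have h1 : ∑ i ∈ s, ∑ j ∈ t, a i * b j * p i j * p i j
      ≤ ∑ i ∈ s, ∑ j ∈ t, (2 * (a i * b j * e i j ^ 2) + 2 * (a i * b j * K ^ 2)) := by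
    refine Finset.sum_le_sum fun i hi => Finset.sum_le_sum fun j hj => ?_
    have h2 : (p i j - e i j) ^ 2 ≤ K ^ 2 := sq_le_sq' (abs_le.1 (hp i hi j hj)).1
      (abs_le.1 (hp i hi j hj)).2
    have h3 : p i j * p i j ≤ 2 * e i j ^ 2 + 2 * K ^ 2 := by
      nlinarith [sq_nonneg (p i j - 2 * e i j)]
    have h4 := mul_le_mul_of_nonneg_left h3 (mul_nonneg (ha i hi) (hb j hj))
    linarith
  have h2 : ∑ i ∈ s, ∑ j ∈ t, (2 * (a i * b j * e i j ^ 2) + 2 * (a i * b j * K ^ 2))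
      = 2 * (∑ i ∈ s, ∑ j ∈ t, a i * b j * e i j ^ 2)
        + 2 * ((∑ i ∈ s, a i) * (∑ j ∈ t, b j) * K ^ 2) := by
    rw [← sum_sum_weights]
    simp only [Finset.sum_add_distrib, Finset.mul_sum]
  have h3 : (∑ i ∈ s, a i) * (∑ j ∈ t, b j) * K ^ 2 ≤ K ^ 2 := by
    have := mul_le_one₀ ha1 (Finset.sum_nonneg hb) hb1
    nlinarith [sq_nonneg K]
  refine (Real.sqrt_le_sqrt (y := (2 * A + 2) * K ^ 2) (by linarith)).trans (le_of_eq ?_)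
  rw [Real.sqrt_mul' _ (sq_nonneg K), Real.sqrt_sq hK]

/-- The error estimate with explicit constants. -/
lemma ElasticData.error_le (h : ElasticData lam mu N ux uy s11 s22 s12)
    (hx : IsGrid x nx) (hy : IsGrid y ny)
    (hsol : MACESol nx ny x y lam mu Wx Wx0 Wxn Wy Wy0 Wyn Z11 Z22 Z12
      (fun i j => pdx s11 (x i, midpt y j) + pdy s12 (x i, midpt y j))
      (fun i j => pdx s12 (midpt x i, y j) + pdy s22 (midpt x i, y j)))
    {K : ℝ} (hK : K = (24 / mu + 9) * (hmax x nx ^ 2 + hmax y ny ^ 2) * N) :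
    Real.sqrt (ipTM x y nx ny
          (fun i j => Wx i j - (ux (x i, midpt y j)
            - (hMid y j) ^ 2 / 8 * pdy (pdy ux) (x i, midpt y j)))
          (fun i j => Wx i j - (ux (x i, midpt y j)
            - (hMid y j) ^ 2 / 8 * pdy (pdy ux) (x i, midpt y j))))
        ≤ Real.sqrt (80 / mu ^ 2 + 34) * K ∧
      Real.sqrt (ipMT x y nx ny
          (fun i j => Wy i j - (uy (midpt x i, y j)
            - (hMid x i) ^ 2 / 8 * pdx (pdx uy) (midpt x i, y j)))
          (fun i j => Wy i j - (uy (midpt x i, y j)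
            - (hMid x i) ^ 2 / 8 * pdx (pdx uy) (midpt x i, y j))))
        ≤ Real.sqrt (80 / mu ^ 2 + 34) * K ∧
      Real.sqrt (ipT x y nx ny
          (fun i j => Z12 i j - s12 (x i, y j)) (fun i j => Z12 i j - s12 (x i, y j)))
        ≤ Real.sqrt (22 + 8 * mu ^ 2) * K := by
  obtain ⟨h1, h2, h3⟩ := h.discrete_error_le hx hy hsol hK
  have hmu := h.mu_pos
  have hN := h.s11_bound.nonneg
  have hK0 : 0 ≤ K := by rw [hK]; positivity
  have hK9 : 9 / mu * (hmax x nx ^ 2 + hmax y ny ^ 2) * N ≤ K := by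
    rw [hK]
    gcongr
    have : 0 ≤ 15 / mu := by positivity
    have : 24 / mu = 9 / mu + 15 / mu := by ring
    linarith
  have e : 80 / mu ^ 2 + 34 = 2 * (40 / mu ^ 2 + 16) + 2 := by ring
  refine ⟨?_, ?_, ?_⟩
  · rw [e]
    refine sqrt_weighted_sum_le hK0
      (fun i hi => (hx.hNode_pos (Finset.mem_Ico.1 hi).2.le).le)
      (fun j hj => (hy.hMid_pos (Finset.mem_range.1 hj)).le)
      hx.sum_hNode_interior_le (by rw [hy.sum_hMid, hy.2.1]) h1 fun i hi j hj => ?_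
    have := h.abs_lifting_sub_le hx hy (Finset.mem_Ico.1 hi).2.le (Finset.mem_range.1 hj)
    rw [sub_sub_sub_cancel_left]
    exact this.trans hK9
  · rw [e]
    refine sqrt_weighted_sum_le hK0
      (fun i hi => (hx.hMid_pos (Finset.mem_range.1 hi)).le)
      (fun j hj => (hy.hNode_pos (Finset.mem_Ico.1 hj).2.le).le)
      (by rw [hx.sum_hMid, hx.2.1]) hy.sum_hNode_interior_le h2 fun i hi j hj => ?_
    have := h.swap.abs_lifting_sub_le hy hx (Finset.mem_Ico.1 hj).2.le (Finset.mem_range.1 hi)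
    rw [sub_sub_sub_cancel_left]
    rw [add_comm (hmax y ny ^ 2)] at this
    exact this.trans hK9
  · rw [show 22 + 8 * mu ^ 2 = 2 * (10 + 4 * mu ^ 2) + 2 by ring]
    exact sqrt_weighted_sum_le hK0
      (fun i hi => (hx.hNode_pos (Nat.lt_succ_iff.1 (Finset.mem_range.1 hi))).le)
      (fun j hj => (hy.hNode_pos (Nat.lt_succ_iff.1 (Finset.mem_range.1 hj))).le)
      hx.sum_hNode.le hy.sum_hNode.le h3 fun i _ j _ => by simpa using hK0

end ErrorEstimate

/-- Superconvergence of the MAC-E scheme for the displacement and the shear stress: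
there are `C, h₀ > 0` depending only on `μ` and the mesh-regularity constant `C₀`
(independent of `h`, `l` and `λ`) such that, if `max(h,l) ≤ h₀`, then
`‖Wˣ - ũˣ‖_{TM} + ‖Wʸ - ũʸ‖_{MT} ≤ C(h²+l²)(‖u‖_{3,∞} + ‖σ‖_{3,∞})` and
`‖Z¹² - σ̃¹²‖_T ≤ Cμ(h²+l²)(‖u‖_{3,∞} + ‖σ‖_{3,∞})`. -/
theorem mac_superconvergence_displacement_shear
    (mu C0 : ℝ) (hmu : 0 < mu) (hC0 : 0 < C0) :
    ∃ C > (0 : ℝ), ∃ h0 > (0 : ℝ), ∀ lam : ℝ, 0 < lam →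
    ∀ (nx ny : ℕ), 2 ≤ nx → 2 ≤ ny → ∀ (x y : ℕ → ℝ),
    IsGrid x nx → IsGrid y ny →
    -- mesh regularity with constant C₀
    (∀ i < nx, C0 * max (hmax x nx) (hmax y ny) ≤ hMid x i) →
    (∀ j < ny, C0 * max (hmax x nx) (hmax y ny) ≤ hMid y j) →
    -- sufficiently fine mesh
    max (hmax x nx) (hmax y ny) ≤ h0 →
    -- the exact solution
    ∀ ux uy : ℝ × ℝ → ℝ, ContDiff ℝ 3 ux → ContDiff ℝ 3 uy →
    (∀ p : ℝ × ℝ, p ∈ Set.Icc ((0 : ℝ), (0 : ℝ)) ((1 : ℝ), (1 : ℝ)) →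
      (p.1 = 0 ∨ p.1 = 1 ∨ p.2 = 0 ∨ p.2 = 1) → ux p = 0 ∧ uy p = 0) →
    ∀ s11 s22 s12 : ℝ × ℝ → ℝ,
    (∀ p, s11 p = (lam + 2 * mu) * pdx ux p + lam * pdy uy p) →
    (∀ p, s22 p = lam * pdx ux p + (lam + 2 * mu) * pdy uy p) →
    (∀ p, s12 p = mu * (pdy ux p + pdx uy p)) →
    ContDiff ℝ 3 s11 → ContDiff ℝ 3 s22 → ContDiff ℝ 3 s12 →
    -- the discrete solution, with data computed from the exact solution
    ∀ (Wx : ℕ → ℕ → ℝ) (Wx0 Wxn : ℕ → ℝ) (Wy : ℕ → ℕ → ℝ) (Wy0 Wyn : ℕ → ℝ)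
      (Z11 Z22 Z12 : ℕ → ℕ → ℝ),
    MACESol nx ny x y lam mu Wx Wx0 Wxn Wy Wy0 Wyn Z11 Z22 Z12
      (fun i j => pdx s11 (x i, midpt y j) + pdy s12 (x i, midpt y j))
      (fun i j => pdx s12 (midpt x i, y j) + pdy s22 (midpt x i, y j)) →
    Real.sqrt (ipTM x y nx ny
          (fun i j => Wx i j - (ux (x i, midpt y j)
            - (hMid y j) ^ 2 / 8 * pdy (pdy ux) (x i, midpt y j)))
          (fun i j => Wx i j - (ux (x i, midpt y j)
            - (hMid y j) ^ 2 / 8 * pdy (pdy ux) (x i, midpt y j))))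
      + Real.sqrt (ipMT x y nx ny
          (fun i j => Wy i j - (uy (midpt x i, y j)
            - (hMid x i) ^ 2 / 8 * pdx (pdx uy) (midpt x i, y j)))
          (fun i j => Wy i j - (uy (midpt x i, y j)
            - (hMid x i) ^ 2 / 8 * pdx (pdx uy) (midpt x i, y j))))
      ≤ C * ((hmax x nx) ^ 2 + (hmax y ny) ^ 2)
          * (max (norm3 ux) (norm3 uy)
            + max (norm3 s11) (max (norm3 s22) (norm3 s12))) ∧
    Real.sqrt (ipT x y nx ny
          (fun i j => Z12 i j - s12 (x i, y j))
          (fun i j => Z12 i j - s12 (x i, y j)))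
      ≤ C * mu * ((hmax x nx) ^ 2 + (hmax y ny) ^ 2)
          * (max (norm3 ux) (norm3 uy)
            + max (norm3 s11) (max (norm3 s22) (norm3 s12))) := by
  set a := Real.sqrt (80 / mu ^ 2 + 34) with ha
  set b := Real.sqrt (22 + 8 * mu ^ 2) with hb
  have ha0 : 0 < a := Real.sqrt_pos.2 (by positivity)
  have hb0 : 0 < b := Real.sqrt_pos.2 (by positivity)
  refine ⟨2 * a * (24 / mu + 9) + b * (24 / mu + 9) / mu, by positivity, 1, one_pos, ?_⟩
  intro lam hlam nx ny _ _ x y hx hy _ _ _ ux uy hux huy hbd s11 s22 s12 h11 h22 h12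
    hs11 hs22 hs12 Wx Wx0 Wxn Wy Wy0 Wyn Z11 Z22 Z12 hsol
  set N := max (norm3 ux) (norm3 uy) + max (norm3 s11) (max (norm3 s22) (norm3 s12)) with hN
  have hu0 : 0 ≤ max (norm3 ux) (norm3 uy) := (boundedC_norm3 hux).nonneg.trans (le_max_left _ _)
  have hvanish : ∀ t ∈ Set.Icc (0 : ℝ) 1, (ux (0, t) = 0 ∧ uy (0, t) = 0) ∧
      (ux (1, t) = 0 ∧ uy (1, t) = 0) ∧ (ux (t, 0) = 0 ∧ uy (t, 0) = 0) ∧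
      (ux (t, 1) = 0 ∧ uy (t, 1) = 0) := fun t ht =>
    ⟨hbd _ (mem_unitSquare (by simp) ht) (by simp), hbd _ (mem_unitSquare (by simp) ht) (by simp),
      hbd _ (mem_unitSquare ht (by simp)) (by simp), hbd _ (mem_unitSquare ht (by simp)) (by simp)⟩
  have hdata : ElasticData lam mu N ux uy s11 s22 s12 :=
    { mu_pos := hmu
      lam_pos := hlam
      contDiff_ux := hux
      contDiff_uy := huy
      ux_boundary := fun t ht => let h := hvanish t ht
        ⟨h.1.1, h.2.1.1, h.2.2.1.1, h.2.2.2.1⟩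
      uy_boundary := fun t ht => let h := hvanish t ht
        ⟨h.1.2, h.2.1.2, h.2.2.1.2, h.2.2.2.2⟩
      s11_eq := h11
      s22_eq := h22
      s12_eq := h12
      s11_bound := (boundedC_norm3 hs11).mono
        ((le_max_left _ _).trans (le_add_of_nonneg_left hu0))
      s22_bound := (boundedC_norm3 hs22).mono
        (((le_max_left _ _).trans (le_max_right _ _)).trans (le_add_of_nonneg_left hu0))
      s12_bound := (boundedC_norm3 hs12).mono
        (((le_max_right _ _).trans (le_max_right _ _)).trans (le_add_of_nonneg_left hu0)) }
  have hN0 : 0 ≤ N := hdata.s11_bound.nonneg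
  obtain ⟨h1, h2, h3⟩ := hdata.error_le hx hy hsol rfl
  constructor
  · refine (add_le_add h1 h2).trans ?_
    have : 0 ≤ b * (24 / mu + 9) / mu * (hmax x nx ^ 2 + hmax y ny ^ 2) * N := by positivity
    linarith
  · refine h3.trans ?_
    have h4 : 0 ≤ 2 * a * (24 / mu + 9) * mu * (hmax x nx ^ 2 + hmax y ny ^ 2) * N := by
      positivity
    have h5 : b * (24 / mu + 9) / mu * mu = b * (24 / mu + 9) := div_mul_cancel₀ _ hmu.ne'
    calc _ = b * (24 / mu + 9) / mu * mu * (hmax x nx ^ 2 + hmax y ny ^ 2) * N := by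
          rw [h5]; ring
      _ ≤ _ := by linarith
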